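/- For every odd prime q and ε ∈ (0,1) there exists a constant C_{ε,q} such that the following holds. Fix an integer A with 1/ε ≤ A ≤ 2/ε; let R = q^{2m} (m ∈ ℕ) be sufficiently large, let r ∈ 4ℕ satisfy q^{q^{A(r−4)}} ≤ R < q^{q^{Ar}}, set R_k := q^{kr}, and let N ∈ ℕ satisfy q^{Nr} ≤ R < q^{(N+1)r}. Let F : ℚ_q² → ℂ be a Schwartz function with Fourier support in Ξ_{1/R}. Then for every k ∈ {0,1,…,N−1} and every interval τ_k ⊂ ℤ_q of length R_k^{-1/2}: ∫_{ℚ_q²} max_{τ_{k+1} ≠ τ'_{k+1}, τ_{k+1},τ'_{k+1} ⊂ τ_k} |F_{τ_{k+1}} F_{τ'_{k+1}}|³ dμ² ≤ C_{ε,q} (log R)^{9+6ε} (∑_{τ_N ⊂ τ_k} ‖F_{τ_N}‖_{L∞(ℚ_q²)}²)² (∑_{τ_N ⊂ τ_k} ∫_{ℚ_q²} |F_{τ_N}|² dμ²), where τ_{k+1}, τ'_{k+1} range over intervals of length R_{k+1}^{-1/2} contained in τ_k, and τ_N over intervals of length R_N^{-1/2} contained in τ_k. -/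

import Mathlib

open MeasureTheory

noncomputable instance (q : ℕ) [Fact q.Prime] : MeasurableSpace ℚ_[q] := borel _
instance (q : ℕ) [Fact q.Prime] : BorelSpace ℚ_[q] := ⟨rfl⟩

/-- The Fourier transform on `ℚ_q²` with respect to the additive character `χ`
and the Haar measure `μ`. -/
noncomputable def qpFourier (q : ℕ) [Fact q.Prime] (μ : Measure ℚ_[q]) [SigmaFinite μ]
    (χ : ℚ_[q] → ℂ) (F : ℚ_[q] × ℚ_[q] → ℂ) (ξη : ℚ_[q] × ℚ_[q]) : ℂ :=
  ∫ x, F x * χ (-(ξη.1 * x.1 + ξη.2 * x.2)) ∂(μ.prod μ)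

/-- The Fourier projection `F_τ` of `F` to the frequency strip `τ × ℚ_q`. -/
noncomputable def qpProj (q : ℕ) [Fact q.Prime] (μ : Measure ℚ_[q]) [SigmaFinite μ]
    (χ : ℚ_[q] → ℂ) (F : ℚ_[q] × ℚ_[q] → ℂ) (τ : Set ℚ_[q]) (x : ℚ_[q] × ℚ_[q]) : ℂ :=
  ∫ ξη in τ ×ˢ (Set.univ : Set ℚ_[q]),
    qpFourier q μ χ F ξη * χ (ξη.1 * x.1 + ξη.2 * x.2) ∂(μ.prod μ)

/-- The interval `{ξ ∈ ℤ_q : |ξ - a| ≤ q^{-ℓ}}`; as `a` runs over `0, …, q^ℓ - 1` these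
enumerate all intervals of length `q^{-ℓ}` inside `ℤ_q`. -/
def qpItv (q : ℕ) [Fact q.Prime] (ℓ a : ℕ) : Set ℚ_[q] :=
  {ξ : ℚ_[q] | ‖ξ - (a : ℚ_[q])‖ ≤ (q : ℝ) ^ (-(ℓ : ℤ))}

open scoped Classical in
/-- Indices `b < q^{ℓ'}` whose associated interval of length `q^{-ℓ'}` is contained in the
interval `qpItv q ℓ a` (equivalently, whose centre lies in it). -/
noncomputable def qpSubItv (q : ℕ) [Fact q.Prime] (ℓ' ℓ a : ℕ) : Finset ℕ :=
  (Finset.range (q ^ ℓ')).filter (fun b => (b : ℚ_[q]) ∈ qpItv q ℓ a)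

namespace BilinAux

/-! ### Part A: combinatorics of pruning, for a fixed vector of values -/

/-- Truncation at height `Λ`. -/
noncomputable def trn (Λ : ℝ) (x : ℂ) : ℂ := if ‖x‖ ≤ Λ then x else 0

theorem trn_zero (Λ : ℝ) : trn Λ 0 = 0 := by simp [trn]

theorem trn_norm_le (Λ : ℝ) (hΛ : 0 ≤ Λ) (x : ℂ) : ‖trn Λ x‖ ≤ Λ := by
  unfold trn; split_ifs with h
  · exact h
  · simpa using hΛ

theorem trn_norm_le_norm (Λ : ℝ) (x : ℂ) : ‖trn Λ x‖ ≤ ‖x‖ := by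
  unfold trn; split_ifs with h
  · exact le_rfl
  · simp

theorem trn_mul (Λ : ℝ) (c x : ℂ) (hc : ‖c‖ = 1) : trn Λ (c * x) = c * trn Λ x := by
  unfold trn; rw [norm_mul, hc, one_mul]; split_ifs <;> simp

theorem trn_sub_norm (Λ : ℝ) (hΛ : 0 < Λ) (x : ℂ) :
    ‖x - trn Λ x‖ ≤ (‖x‖ ^ 2 - ‖trn Λ x‖ ^ 2) / Λ := by
  unfold trn; split_ifs with h
  · simp
  · push Not at h
    rw [le_div_iff₀ hΛ]; simp only [sub_zero, norm_zero]
    nlinarith [norm_nonneg x]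

/-- Pruned sums, indexed by the number `d` of steps from the finest level `D`. -/
noncomputable def uu (q D : ℕ) (Λ : ℝ) (v : ℕ → ℂ) : ℕ → ℕ → ℂ
  | 0, c => v c
  | d + 1, c => ∑ i ∈ Finset.range q, trn Λ (uu q D Λ v d (c + i * q ^ (D - (d + 1))))

/-- Pruned sums at level `n`. -/
noncomputable def lv (q D : ℕ) (Λ : ℝ) (v : ℕ → ℂ) (n c : ℕ) : ℂ := uu q D Λ v (D - n) c

variable {q D : ℕ} {Λ : ℝ} {v : ℕ → ℂ}

theorem lv_top (c : ℕ) : lv q D Λ v D c = v c := by simp [lv, uu]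

theorem lv_step {n : ℕ} (hn : n < D) (c : ℕ) :
    lv q D Λ v n c = ∑ i ∈ Finset.range q, trn Λ (lv q D Λ v (n + 1) (c + i * q ^ n)) := by
  unfold lv
  have h : D - n = (D - (n + 1)) + 1 := by omega
  rw [h, uu]
  have h2 : D - (D - (n + 1) + 1) = n := by omega
  rw [h2]

theorem sum_split {M : Type*} [AddCommMonoid M] (q n : ℕ) (φ : ℕ → M) :
    ∑ c ∈ Finset.range (q ^ (n + 1)), φ c
      = ∑ c ∈ Finset.range (q ^ n), ∑ i ∈ Finset.range q, φ (c + i * q ^ n) := by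
  rw [Finset.sum_comm]
  have key : ∀ (j N : ℕ), ∑ c ∈ Finset.range (j * N), φ c
      = ∑ i ∈ Finset.range j, ∑ c ∈ Finset.range N, φ (c + i * N) := by
    intro j N
    induction j with
    | zero => simp
    | succ j ih =>
      rw [Finset.sum_range_succ, ← ih, add_mul, one_mul, Finset.sum_range_add]
      congr 1
      exact Finset.sum_congr rfl fun c _ => by rw [add_comm]
  rw [pow_succ, mul_comm]
  exact key q (q ^ n)

noncomputable def gg (q D : ℕ) (Λ : ℝ) (v : ℕ → ℂ) (n : ℕ) : ℝ :=
  ∑ c ∈ Finset.range (q ^ n), ‖lv q D Λ v n c‖ ^ 2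
noncomputable def pp (q D : ℕ) (Λ : ℝ) (v : ℕ → ℂ) (n : ℕ) : ℝ :=
  ∑ c ∈ Finset.range (q ^ n), ‖trn Λ (lv q D Λ v n c)‖ ^ 2
noncomputable def hc (q D : ℕ) (Λ : ℝ) (v : ℕ → ℂ) (n c : ℕ) : ℝ :=
  ‖lv q D Λ v n c‖ ^ 2
    - ∑ i ∈ Finset.range q, ‖trn Λ (lv q D Λ v (n + 1) (c + i * q ^ n))‖ ^ 2
noncomputable def hh (q D : ℕ) (Λ : ℝ) (v : ℕ → ℂ) (n : ℕ) : ℝ :=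
  ∑ c ∈ Finset.range (q ^ n), hc q D Λ v n c
noncomputable def HH (q D : ℕ) (Λ : ℝ) (v : ℕ → ℂ) (n : ℕ) : ℝ :=
  ∑ l ∈ Finset.Ico n D, hh q D Λ v l
noncomputable def GG (q D : ℕ) (Λ : ℝ) (v : ℕ → ℂ) (n : ℕ) : ℝ :=
  gg q D Λ v D + HH q D Λ v n
noncomputable def BB (q D : ℕ) (Λ : ℝ) (v : ℕ → ℂ) (n : ℕ) : ℝ :=
  ∑ l ∈ Finset.Ico (n + 1) (D + 1), (gg q D Λ v l - pp q D Λ v l)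
noncomputable def AA (q D : ℕ) (Λ : ℝ) (v : ℕ → ℂ) (k i : ℕ) : ℂ :=
  ∑ c ∈ (Finset.range (q ^ k)).filter (fun c => c % q = i), lv q D Λ v k c

theorem gg_nonneg (n : ℕ) : 0 ≤ gg q D Λ v n := Finset.sum_nonneg fun _ _ => by positivity
theorem pp_nonneg (n : ℕ) : 0 ≤ pp q D Λ v n := Finset.sum_nonneg fun _ _ => by positivity
theorem pp_le_gg (n : ℕ) : pp q D Λ v n ≤ gg q D Λ v n :=
  Finset.sum_le_sum fun c _ => by
    gcongr; exact trn_norm_le_norm _ _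

theorem hh_eq (n : ℕ) : hh q D Λ v n = gg q D Λ v n - pp q D Λ v (n + 1) := by
  unfold hh hc gg pp
  rw [sum_split, Finset.sum_sub_distrib]

theorem BB_nonneg (n : ℕ) : 0 ≤ BB q D Λ v n :=
  Finset.sum_nonneg fun _ _ => sub_nonneg.2 (pp_le_gg _)

theorem BB_step {n : ℕ} (hn : n < D) :
    BB q D Λ v n = (gg q D Λ v (n + 1) - pp q D Λ v (n + 1)) + BB q D Λ v (n + 1) := by
  unfold BB
  rw [Finset.sum_eq_sum_Ico_succ_bot (by omega)]

theorem HH_step {n : ℕ} (hn : n < D) :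
    HH q D Λ v n = hh q D Λ v n + HH q D Λ v (n + 1) := by
  unfold HH
  rw [Finset.sum_eq_sum_Ico_succ_bot (by omega)]

theorem GG_eq {n : ℕ} (hn : n ≤ D) : GG q D Λ v n = gg q D Λ v n + BB q D Λ v n := by
  induction hn using Nat.decreasingInduction with
  | self => simp [GG, HH, BB]
  | of_succ k hk ih =>
    unfold GG at ih ⊢
    rw [HH_step hk, BB_step hk, hh_eq]
    linarith

theorem gg_le_GG {n : ℕ} (hn : n ≤ D) : gg q D Λ v n ≤ GG q D Λ v n := by
  rw [GG_eq hn]; linarith [BB_nonneg (q := q) (D := D) (Λ := Λ) (v := v) n]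

theorem BB_le_GG {n : ℕ} (hn : n < D) : BB q D Λ v n ≤ GG q D Λ v (n + 1) := by
  rw [GG_eq (by omega), BB_step hn]
  linarith [pp_nonneg (q := q) (D := D) (Λ := Λ) (v := v) (n + 1)]

theorem AA_step {k : ℕ} (hk : 1 ≤ k) (hkD : k < D) (i : ℕ) :
    AA q D Λ v k i = ∑ c ∈ (Finset.range (q ^ (k + 1))).filter (fun c => c % q = i),
      trn Λ (lv q D Λ v (k + 1) c) := by
  unfold AA
  rw [Finset.sum_filter, Finset.sum_filter, sum_split]
  refine Finset.sum_congr rfl fun c _ => ?_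
  have h : ∀ j, (c + j * q ^ k) % q = c % q := by
    intro j
    obtain ⟨k', rfl⟩ : ∃ k', k = k' + 1 := ⟨k - 1, by omega⟩
    rw [pow_succ, ← mul_assoc, Nat.add_mul_mod_self_right]
  simp only [h]
  split_ifs with h2
  · rw [lv_step hkD]
  · simp

theorem AA_diff (hΛ : 0 < Λ) {k : ℕ} (hk : 1 ≤ k) (hkD : k ≤ D) (i : ℕ) :
    ‖AA q D Λ v D i - AA q D Λ v k i‖ ≤ BB q D Λ v k / Λ := by
  induction hkD using Nat.decreasingInduction with
  | self => simpa using div_nonneg (BB_nonneg _) hΛ.le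
  | of_succ k hkD ih =>
    have ih := ih (by omega)
    have h1 : ‖AA q D Λ v (k + 1) i - AA q D Λ v k i‖
        ≤ (gg q D Λ v (k + 1) - pp q D Λ v (k + 1)) / Λ := by
      rw [AA_step hk hkD]
      unfold AA gg pp
      rw [← Finset.sum_sub_distrib, ← Finset.sum_sub_distrib, Finset.sum_div]
      refine (norm_sum_le _ _).trans ?_
      refine (Finset.sum_le_sum fun c _ => trn_sub_norm Λ hΛ _).trans ?_
      refine Finset.sum_le_sum_of_subset_of_nonneg (Finset.filter_subset _ _) fun c _ _ => ?_
      refine div_nonneg (sub_nonneg.2 ?_) hΛ.le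
      gcongr; exact trn_norm_le_norm _ _
    rw [BB_step hkD, add_div]
    calc _ = ‖(AA q D Λ v (k + 1) i - AA q D Λ v k i)
        + (AA q D Λ v D i - AA q D Λ v (k + 1) i)‖ := by congr 1; ring
      _ ≤ _ := (norm_add_le _ _).trans (add_le_add h1 ih)

/-- The stopping set at level `k`. -/
def EE (q D : ℕ) (Λ lam : ℝ) (v : ℕ → ℂ) (k : ℕ) : Prop :=
  2 * lam < GG q D Λ v k ∧ ∀ l, k < l → l ≤ D → GG q D Λ v l ≤ 2 * lam

theorem AA_one {i : ℕ} (hi : i < q) : ‖AA q D Λ v 1 i‖ ^ 2 ≤ gg q D Λ v 1 := by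
  have h : (Finset.range (q ^ 1)).filter (fun c => c % q = i) = {i} := by
    ext c
    simp only [pow_one, Finset.mem_filter, Finset.mem_range, Finset.mem_singleton]
    constructor
    · rintro ⟨h1, h2⟩; rwa [Nat.mod_eq_of_lt h1] at h2
    · rintro rfl; exact ⟨hi, Nat.mod_eq_of_lt hi⟩
  unfold AA gg
  rw [h, Finset.sum_singleton]
  exact Finset.single_le_sum (f := fun c => ‖lv q D Λ v 1 c‖ ^ 2)
    (fun _ _ => by positivity) (by simpa using hi)

theorem prune_level {lam β : ℝ} (hlam : 0 < lam) (hβ : 0 < β) (hβ2 : 8 * lam < β ^ 2)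
    (hΛ : Λ = 4 * lam / β) (hD : 1 ≤ D) (hg : gg q D Λ v D ≤ lam) {i i' : ℕ} (hi : i < q)
    (h1 : β ≤ ‖AA q D Λ v D i‖) (h2 : β ≤ ‖AA q D Λ v D i'‖) :
    ∃ k ∈ Finset.Ico 1 D, EE q D Λ lam v k ∧ β / 2 ≤ ‖AA q D Λ v k i‖ ∧
      β / 2 ≤ ‖AA q D Λ v k i'‖ := by
  have hΛ0 : 0 < Λ := by rw [hΛ]; positivity
  have hdiv : 2 * lam / Λ = β / 2 := by rw [hΛ]; field_simp; ring
  have hGD : GG q D Λ v D ≤ lam := by simpa [GG, HH] using hg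
  have low : ∀ k, 1 ≤ k → k ≤ D → BB q D Λ v k ≤ 2 * lam → ∀ j, β ≤ ‖AA q D Λ v D j‖ →
      β / 2 ≤ ‖AA q D Λ v k j‖ := by
    intro k hk hkD hB j hj
    have h3 := AA_diff (v := v) (q := q) hΛ0 hk hkD j
    have h4 : BB q D Λ v k / Λ ≤ β / 2 := by rw [← hdiv]; gcongr
    have h5 := norm_sub_norm_le (AA q D Λ v D j) (AA q D Λ v k j)
    linarith
  by_cases hex : ∃ n, 1 ≤ n ∧ n ≤ D ∧ 2 * lam < GG q D Λ v n
  · classical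
    obtain ⟨n, hn1, hnD, hn⟩ := hex
    set P : ℕ → Prop := fun n => 2 * lam < GG q D Λ v n
    set k := Nat.findGreatest P D with hk
    have hPk : P k := Nat.findGreatest_spec hnD hn
    have hnk : n ≤ k := Nat.le_findGreatest hnD hn
    have hkD : k ≤ D := Nat.findGreatest_le D
    have hkne : k ≠ D := by
      intro h
      have h3 : 2 * lam < GG q D Λ v k := hPk
      rw [h] at h3; linarith
    have hE : EE q D Λ lam v k := by
      refine ⟨hPk, fun l hl hlD => ?_⟩
      have := Nat.findGreatest_is_greatest hl hlD
      exact not_lt.1 this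
    have hB : BB q D Λ v k ≤ 2 * lam :=
      (BB_le_GG (by omega)).trans (hE.2 (k + 1) (by omega) (by omega))
    refine ⟨k, Finset.mem_Ico.2 ⟨by omega, by omega⟩, hE, ?_, ?_⟩
    · exact low k (by omega) hkD hB i h1
    · exact low k (by omega) hkD hB i' h2
  · exfalso
    push Not at hex
    have hG1 := hex 1 le_rfl hD
    have hB : BB q D Λ v 1 ≤ 2 * lam := by
      rw [GG_eq hD] at hG1; linarith [gg_nonneg (q := q) (D := D) (Λ := Λ) (v := v) 1]
    have h3 := low 1 le_rfl hD hB i h1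
    have h4 := (AA_one (D := D) (Λ := Λ) (v := v) hi).trans (gg_le_GG hD)
    nlinarith

theorem gg_sq_le {lam : ℝ} {k : ℕ} (hk : k ≤ D) (hg : gg q D Λ v D ≤ lam)
    (hE : 2 * lam < GG q D Λ v k) : gg q D Λ v k ^ 2 ≤ 4 * HH q D Λ v k ^ 2 := by
  have h1 := gg_le_GG (q := q) (Λ := Λ) (v := v) hk
  have h0 := gg_nonneg (q := q) (D := D) (Λ := Λ) (v := v) k
  have h2 : gg q D Λ v k ≤ 2 * HH q D Λ v k := by unfold GG at *; linarith
  nlinarith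

theorem hc_sq_le (hq : 1 ≤ q) (hΛ : 0 ≤ Λ) {n : ℕ} (hn : n < D) (c : ℕ) :
    hc q D Λ v n c ^ 2 ≤ (q : ℝ) ^ 3 * Λ ^ 2 *
      ∑ i ∈ Finset.range q, ‖trn Λ (lv q D Λ v (n + 1) (c + i * q ^ n))‖ ^ 2 := by
  unfold hc
  rw [lv_step hn]
  set x : ℕ → ℂ := fun i => trn Λ (lv q D Λ v (n + 1) (c + i * q ^ n)) with hx
  set s := ∑ i ∈ Finset.range q, ‖x i‖ ^ 2 with hs
  have hs0 : 0 ≤ s := Finset.sum_nonneg fun _ _ => by positivity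
  have hq' : (1 : ℝ) ≤ q := by exact_mod_cast hq
  have hsΛ : s ≤ q * Λ ^ 2 := by
    calc s ≤ ∑ i ∈ Finset.range q, Λ ^ 2 :=
          Finset.sum_le_sum fun i _ => by gcongr; exact trn_norm_le _ hΛ _
      _ = _ := by simp
  have h1 : ‖∑ i ∈ Finset.range q, x i‖ ^ 2 ≤ q * s := by
    calc ‖∑ i ∈ Finset.range q, x i‖ ^ 2 ≤ (∑ i ∈ Finset.range q, ‖x i‖) ^ 2 := by
          gcongr; exact norm_sum_le _ _
      _ ≤ _ := by simpa using sq_sum_le_card_mul_sum_sq (s := Finset.range q) (f := fun i => ‖x i‖)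
  have h2 : (0:ℝ) ≤ ‖∑ i ∈ Finset.range q, x i‖ ^ 2 := by positivity
  have h3 : |‖∑ i ∈ Finset.range q, x i‖ ^ 2 - s| ≤ q * s := by
    rw [abs_le]; constructor <;> nlinarith
  calc (‖∑ i ∈ Finset.range q, x i‖ ^ 2 - s) ^ 2 ≤ (q * s) ^ 2 := by
        rw [← sq_abs]; gcongr
    _ = q ^ 2 * s * s := by ring
    _ ≤ q ^ 2 * (q * Λ ^ 2) * s := by gcongr
    _ = _ := by ring

theorem hc_ofReal {n : ℕ} (hn : n < D) (c : ℕ) :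
    ((hc q D Λ v n c : ℝ) : ℂ) = ∑ i ∈ Finset.range q, ∑ i' ∈ (Finset.range q).erase i,
      trn Λ (lv q D Λ v (n + 1) (c + i * q ^ n)) *
        (starRingEnd ℂ) (trn Λ (lv q D Λ v (n + 1) (c + i' * q ^ n))) := by
  unfold hc
  rw [lv_step hn]
  set x : ℕ → ℂ := fun i => trn Λ (lv q D Λ v (n + 1) (c + i * q ^ n)) with hx
  have hsq : ∀ y : ℂ, ((‖y‖ ^ 2 : ℝ) : ℂ) = y * (starRingEnd ℂ) y := by
    intro y; rw [Complex.mul_conj, Complex.normSq_eq_norm_sq]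
  push_cast [-Complex.ofReal_pow]
  rw [hsq, map_sum, Finset.sum_mul_sum, ← Finset.sum_sub_distrib]
  refine Finset.sum_congr rfl fun i hi => ?_
  rw [hsq, ← Finset.add_sum_erase _ _ hi]
  simp

/-! ### vanishing at the zero vector -/

theorem lv_zero (n c : ℕ) : lv q D Λ 0 n c = 0 := by
  unfold lv
  generalize D - n = d
  induction d generalizing c with
  | zero => simp [uu]
  | succ d ih => simp [uu, ih, trn_zero]

theorem gg_zero (n : ℕ) : gg q D Λ 0 n = 0 := by simp [gg, lv_zero]
theorem pp_zero (n : ℕ) : pp q D Λ 0 n = 0 := by simp [pp, lv_zero, trn_zero]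
theorem hc_zero (n c : ℕ) : hc q D Λ 0 n c = 0 := by simp [hc, lv_zero, trn_zero]
theorem hh_zero (n : ℕ) : hh q D Λ 0 n = 0 := by simp [hh, hc_zero]
theorem HH_zero (n : ℕ) : HH q D Λ 0 n = 0 := by simp [HH, hh_zero]
theorem GG_zero (n : ℕ) : GG q D Λ 0 n = 0 := by simp [GG, HH_zero, gg_zero]
theorem AA_zero (n c : ℕ) : AA q D Λ 0 n c = 0 := by simp [AA, lv_zero]


/-! ### Part B: characters, equivariance and orthogonality -/

structure IsChar (q : ℕ) [Fact q.Prime] (χ : ℚ_[q] → ℂ) : Prop where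
  mul : ∀ x y : ℚ_[q], χ (x + y) = χ x * χ y
  nrm : ∀ x : ℚ_[q], ‖χ x‖ = 1
  triv : ∀ x : ℚ_[q], ‖x‖ ≤ 1 → χ x = 1
  nontriv : ∃ x : ℚ_[q], ‖x‖ ≤ (q : ℝ) ∧ χ x ≠ 1

section padic

variable {p : ℕ} [hp : Fact p.Prime] {χ : ℚ_[p] → ℂ}

theorem one_lt_p : (1 : ℝ) < p := by exact_mod_cast hp.out.one_lt

theorem IsChar.conj (hχ : IsChar p χ) (x : ℚ_[p]) : (starRingEnd ℂ) (χ x) = χ (-x) := by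
  have h1 : χ x * χ (-x) = 1 := by
    rw [← hχ.mul, add_neg_cancel]; exact hχ.triv 0 (by simp)
  have h2 : χ x * (starRingEnd ℂ) (χ x) = 1 := by
    rw [Complex.mul_conj, Complex.normSq_eq_norm_sq, hχ.nrm]; simp
  have h0 : χ x ≠ 0 := by
    intro h; rw [h, zero_mul] at h1; exact zero_ne_one h1
  exact mul_left_cancel₀ h0 (h2.trans h1.symm)

theorem IsChar.congr (hχ : IsChar p χ) {x y : ℚ_[p]} (h : ‖x - y‖ ≤ 1) : χ x = χ y := by
  have : x = (x - y) + y := by ring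
  rw [this, hχ.mul, hχ.triv _ h, one_mul]

theorem norm_add_le_of {x y : ℚ_[p]} {B : ℝ} (hx : ‖x‖ ≤ B) (hy : ‖y‖ ≤ B) : ‖x + y‖ ≤ B :=
  (Padic.nonarchimedean x y).trans (max_le hx hy)

theorem norm_sub_le_of {x y : ℚ_[p]} {B : ℝ} (hx : ‖x‖ ≤ B) (hy : ‖y‖ ≤ B) : ‖x - y‖ ≤ B := by
  rw [sub_eq_add_neg]; exact norm_add_le_of hx (by rwa [norm_neg])

theorem norm_nat_le (n : ℕ) : ‖(n : ℚ_[p])‖ ≤ 1 := by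
  simpa using Padic.norm_int_le_one (p := p) (n : ℤ)

theorem norm_two (h2 : p ≠ 2) : ‖(2 : ℚ_[p])‖ = 1 := by
  have h := Padic.norm_natCast_eq_one_iff (p := p) (n := 2)
  rw [Nat.cast_ofNat] at h
  exact h.2 ((Nat.coprime_primes hp.out Nat.prime_two).2 h2)

theorem norm_dvd {a b n : ℕ} (h : ‖(a : ℚ_[p]) - b‖ ≤ ((p : ℝ) ^ n)⁻¹) : a % p ^ n = b % p ^ n := by
  have h1 : ((p ^ n : ℕ) : ℤ) ∣ ((a : ℤ) - b) := by
    have := (Padic.norm_int_le_pow_iff_dvd (p := p) ((a : ℤ) - b) n).1 (by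
      push_cast; rw [zpow_neg, zpow_natCast]; exact h)
    exact_mod_cast this
  exact ((Nat.modEq_iff_dvd).2 h1).symm

theorem norm_of_mod {a b n : ℕ} (h : a % p ^ n = b % p ^ n) :
    ‖(a : ℚ_[p]) - b‖ ≤ ((p : ℝ) ^ n)⁻¹ := by
  have h1 : ((p ^ n : ℕ) : ℤ) ∣ ((a : ℤ) - b) := (Nat.modEq_iff_dvd).1 (Eq.symm h)
  have := (Padic.norm_int_le_pow_iff_dvd (p := p) ((a : ℤ) - b) n).2 (by exact_mod_cast h1)
  push_cast at this; rwa [zpow_neg, zpow_natCast] at this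

theorem norm_ge_of {x : ℚ_[p]} {n : ℕ} (h : ¬ ‖x‖ ≤ ((p : ℝ) ^ n)⁻¹) :
    (p : ℝ) ≤ ‖x‖ * (p : ℝ) ^ n := by
  have hp1 := one_lt_p (p := p)
  have h2 := Padic.norm_le_pow_iff_norm_lt_pow_add_one x (-(n : ℤ))
  rw [zpow_neg, zpow_natCast] at h2
  have h3 : ¬ ‖x‖ < (p : ℝ) ^ (-(n : ℤ) + 1) := fun h' => h (h2.2 h')
  push Not at h3
  rw [zpow_add₀ (by positivity), zpow_neg, zpow_natCast, zpow_one] at h3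
  have hpn : (0 : ℝ) < (p : ℝ) ^ n := by positivity
  calc (p : ℝ) = (((p : ℝ) ^ n)⁻¹ * p) * (p : ℝ) ^ n := by field_simp
    _ ≤ _ := by gcongr

/-- centre of the node `c` in the tree with root `(a0, j)`. -/
noncomputable def cen (p : ℕ) [Fact p.Prime] (j a0 c : ℕ) : ℚ_[p] := ((a0 + c * p ^ j : ℕ) : ℚ_[p])

variable {j D a0 : ℕ}

theorem cen_norm (c : ℕ) : ‖cen p j a0 c‖ ≤ 1 := norm_nat_le _

theorem cen_sub (c c' : ℕ) : ‖cen p j a0 c - cen p j a0 c'‖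
    = ‖(c : ℚ_[p]) - c'‖ * ((p : ℝ) ^ j)⁻¹ := by
  have : cen p j a0 c - cen p j a0 c' = ((c : ℚ_[p]) - c') * (p : ℚ_[p]) ^ j := by
    unfold cen; push_cast; ring
  rw [this, norm_mul, norm_pow, Padic.norm_p, inv_pow]

theorem cen_child (c i n : ℕ) :
    ‖cen p j a0 (c + i * p ^ n) - cen p j a0 c‖ ≤ ((p : ℝ) ^ (j + n))⁻¹ := by
  rw [cen_sub, pow_add, mul_inv, mul_comm]
  gcongr
  apply norm_of_mod
  simp

theorem cen_close {c c' n : ℕ} (h : c % p ^ n = c' % p ^ n) :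
    ‖cen p j a0 c - cen p j a0 c'‖ ≤ ((p : ℝ) ^ (j + n))⁻¹ := by
  rw [cen_sub, pow_add, mul_inv, mul_comm]
  gcongr
  exact norm_of_mod h

theorem cen_root (c c' : ℕ) :
    ‖cen p j a0 c - cen p j a0 c'‖ ≤ ((p : ℝ) ^ j)⁻¹ := by
  simpa using cen_close (p := p) (j := j) (a0 := a0) (c := c) (c' := c') (n := 0) (by simp [Nat.mod_one])

theorem cen_far' {c c' n : ℕ} (h : c % p ^ n ≠ c' % p ^ n) :
    (p : ℝ) ≤ ‖cen p j a0 c - cen p j a0 c'‖ * (p : ℝ) ^ (j + n) := by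
  have hp1 := one_lt_p (p := p)
  have h1 := norm_ge_of (p := p) (x := (c : ℚ_[p]) - c') (n := n) (fun h' => h (norm_dvd h'))
  rw [cen_sub, pow_add]
  have : (0 : ℝ) < (p : ℝ) ^ j := by positivity
  calc (p : ℝ) ≤ _ := h1
    _ = _ := by field_simp

theorem cen_far {c c' n : ℕ} (hc : c < p ^ n) (hc' : c' < p ^ n) (h : c ≠ c') :
    (p : ℝ) ≤ ‖cen p j a0 c - cen p j a0 c'‖ * (p : ℝ) ^ (j + n) :=
  cen_far' (by rwa [Nat.mod_eq_of_lt hc, Nat.mod_eq_of_lt hc'])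

theorem recentre (hχ : IsChar p χ) {a a' s t : ℚ_[p]} {Q : ℝ} (hQ : 0 < Q) (ha : ‖a' - a‖ ≤ Q⁻¹)
    (hs : ‖s + 2 * a * t‖ ≤ Q) (ht : ‖t‖ ≤ Q ^ 2) :
    ‖s + 2 * a' * t‖ ≤ Q ∧ χ (a' * s + a' ^ 2 * t) = χ (a * s + a ^ 2 * t) := by
  have h2 : ‖(2 : ℚ_[p])‖ ≤ 1 := by simpa using norm_nat_le (p := p) 2
  have h3 : ‖(a' - a) * t‖ ≤ Q := by
    rw [norm_mul]
    calc ‖a' - a‖ * ‖t‖ ≤ Q⁻¹ * Q ^ 2 := by gcongr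
      _ = Q := by field_simp
  constructor
  · have : s + 2 * a' * t = (s + 2 * a * t) + 2 * ((a' - a) * t) := by ring
    rw [this]
    refine norm_add_le_of hs ?_
    rw [norm_mul]
    nlinarith [norm_nonneg ((a' - a) * t)]
  · apply hχ.congr
    have : a' * s + a' ^ 2 * t - (a * s + a ^ 2 * t)
        = (a' - a) * (s + 2 * a * t) + (a' - a) * ((a' - a) * t) := by ring
    rw [this]
    have key : ∀ y : ℚ_[p], ‖y‖ ≤ Q → ‖(a' - a) * y‖ ≤ 1 := by
      intro y hy
      rw [norm_mul]
      calc ‖a' - a‖ * ‖y‖ ≤ Q⁻¹ * Q := by gcongr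
        _ = 1 := by field_simp
    exact norm_add_le_of (key _ hs) (key _ h3)

/-- A finite family of functions adapted to the intervals of level `j + D` below `(a0, j)`. -/
structure Fam (p : ℕ) [Fact p.Prime] (χ : ℚ_[p] → ℂ) (j D a0 : ℕ)
    (f : ℕ → ℚ_[p] × ℚ_[p] → ℂ) : Prop where
  eqv : ∀ c z s t, ‖s + 2 * cen p j a0 c * t‖ ≤ (p : ℝ) ^ (j + D) →
    ‖t‖ ≤ ((p : ℝ) ^ (j + D)) ^ 2 →
    f c (z + (s, t)) = χ (cen p j a0 c * s + cen p j a0 c ^ 2 * t) * f c z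
  supp : ∃ M : ℝ, ∀ c z, M < ‖z‖ → f c z = 0

/-- the vector of values -/
def vec {X : Type*} (f : ℕ → X → ℂ) (z : X) : ℕ → ℂ := fun c => f c z

variable {f : ℕ → ℚ_[p] × ℚ_[p] → ℂ} {Λ : ℝ}

theorem one_le_ppow (n : ℕ) : (1 : ℝ) ≤ (p : ℝ) ^ n := one_le_pow₀ (one_lt_p (p := p)).le

theorem Fam.unit (hf : Fam p χ j D a0 f) (hχ : IsChar p χ) (z w : ℚ_[p] × ℚ_[p]) (hw : ‖w‖ ≤ 1) :
    vec f (z + w) = vec f z := by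
  funext c
  obtain ⟨s, t⟩ := w
  have hs : ‖s‖ ≤ 1 := (norm_fst_le _).trans hw
  have ht : ‖t‖ ≤ 1 := (norm_snd_le _).trans hw
  have hc := cen_norm (p := p) (j := j) (a0 := a0) c
  have h2 : ‖(2 : ℚ_[p])‖ ≤ 1 := by simpa using norm_nat_le (p := p) 2
  have mm : ∀ x y : ℚ_[p], ‖x‖ ≤ 1 → ‖y‖ ≤ 1 → ‖x * y‖ ≤ 1 := fun x y hx hy => by
    rw [norm_mul]; exact mul_le_one₀ hx (norm_nonneg _) hy
  unfold vec
  rw [hf.eqv c z s t]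
  · rw [hχ.triv, one_mul]
    exact norm_add_le_of (mm _ _ hc hs) (mm _ _ (by rw [sq]; exact mm _ _ hc hc) ht)
  · exact (norm_add_le_of hs (mm _ _ (mm _ _ h2 hc) ht)).trans (one_le_ppow _)
  · exact ht.trans (one_le_pow₀ (one_le_ppow _))

theorem nice_continuous {E : Type*} [TopologicalSpace E] {φ : ℚ_[p] × ℚ_[p] → E} {δ : ℝ}
    (hδ : 0 < δ) (h : ∀ z w, ‖w‖ ≤ δ → φ (z + w) = φ z) : Continuous φ := by
  rw [continuous_iff_continuousAt]
  intro z
  have : φ =ᶠ[nhds z] fun _ => φ z := by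
    filter_upwards [Metric.ball_mem_nhds z hδ] with y hy
    have := h z (y - z) (by rw [← dist_eq_norm]; exact (Metric.mem_ball.1 hy).le)
    simpa using this
  exact continuousAt_const.congr this.symm

theorem nice_hcs {E : Type*} [Zero E] {φ : ℚ_[p] × ℚ_[p] → E} {M : ℝ}
    (h : ∀ z, M < ‖z‖ → φ z = 0) : HasCompactSupport φ := by
  apply HasCompactSupport.intro (isCompact_closedBall (0 : ℚ_[p] × ℚ_[p]) M)
  intro z hz
  apply h
  simpa using hz

theorem Fam.cont (hf : Fam p χ j D a0 f) (hχ : IsChar p χ) {E : Type*} [TopologicalSpace E]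
    (Ψ : (ℕ → ℂ) → E) : Continuous (fun z => Ψ (vec f z)) :=
  nice_continuous one_pos fun z w hw => by rw [hf.unit hχ z w hw]

variable (μ : Measure ℚ_[p]) [μ.IsAddHaarMeasure] [SigmaFinite μ]

theorem Fam.integrable (hf : Fam p χ j D a0 f) (hχ : IsChar p χ) {E : Type*} [NormedAddCommGroup E]
    (Ψ : (ℕ → ℂ) → E) (h0 : Ψ 0 = 0) : Integrable (fun z => Ψ (vec f z)) (μ.prod μ) := by
  obtain ⟨M, hM⟩ := hf.supp
  refine (hf.cont hχ Ψ).integrable_of_hasCompactSupport (nice_hcs (M := M) fun z hz => ?_)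
  have : vec f z = 0 := by funext c; exact hM c z hz
  rw [this, h0]

theorem vanish {φ : ℚ_[p] × ℚ_[p] → ℂ} (w : ℚ_[p] × ℚ_[p]) (c : ℂ) (hc : c ≠ 1)
    (h : ∀ z, φ (z + w) = c * φ z) : ∫ z, φ z ∂(μ.prod μ) = 0 := by
  have h1 := integral_add_right_eq_self (μ := μ.prod μ) φ w
  simp only [h] at h1
  rw [integral_const_mul] at h1
  have : (c - 1) * ∫ z, φ z ∂(μ.prod μ) = 0 := by rw [sub_mul, one_mul, h1, sub_self]
  exact (mul_eq_zero.1 this).resolve_left (sub_ne_zero.2 hc)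

theorem Fam.lv_eqv (hf : Fam p χ j D a0 f) (hχ : IsChar p χ) {n : ℕ} (hn : n ≤ D) :
    ∀ (c : ℕ) (z : ℚ_[p] × ℚ_[p]) (s t : ℚ_[p]), ‖s + 2 * cen p j a0 c * t‖ ≤ (p : ℝ) ^ (j + n) →
    ‖t‖ ≤ ((p : ℝ) ^ (j + n)) ^ 2 →
    lv p D Λ (vec f (z + (s, t))) n c
      = χ (cen p j a0 c * s + cen p j a0 c ^ 2 * t) * lv p D Λ (vec f z) n c := by
  induction hn using Nat.decreasingInduction with
  | self =>
    intro c z s t hs ht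
    rw [lv_top, lv_top]; exact hf.eqv c z s t hs ht
  | of_succ n hn ih =>
    intro c z s t hs ht
    rw [lv_step hn, lv_step hn, Finset.mul_sum]
    refine Finset.sum_congr rfl fun i _ => ?_
    have hp1 := one_lt_p (p := p)
    have hle : (p : ℝ) ^ (j + n) ≤ (p : ℝ) ^ (j + (n + 1)) :=
      pow_le_pow_right₀ hp1.le (by omega)
    obtain ⟨h1, h2⟩ := recentre hχ (by positivity) (cen_child (p := p) (j := j) (a0 := a0) c i n) hs ht
    rw [ih _ z s t (h1.trans hle) (ht.trans (by gcongr)), h2, trn_mul _ _ _ (hχ.nrm _)]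

theorem Fam.trn_eqv (hf : Fam p χ j D a0 f) (hχ : IsChar p χ) {n : ℕ} (hn : n ≤ D)
    (c : ℕ) (z : ℚ_[p] × ℚ_[p]) (s t : ℚ_[p]) (hs : ‖s + 2 * cen p j a0 c * t‖ ≤ (p : ℝ) ^ (j + n))
    (ht : ‖t‖ ≤ ((p : ℝ) ^ (j + n)) ^ 2) :
    trn Λ (lv p D Λ (vec f (z + (s, t))) n c)
      = χ (cen p j a0 c * s + cen p j a0 c ^ 2 * t) * trn Λ (lv p D Λ (vec f z) n c) := by
  rw [hf.lv_eqv hχ hn c z s t hs ht, trn_mul _ _ _ (hχ.nrm _)]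

theorem pair_char (hχ : IsChar p χ) (a a' s t : ℚ_[p]) (x x' : ℂ) :
    (χ (a * s + a ^ 2 * t) * x) * (starRingEnd ℂ) (χ (a' * s + a' ^ 2 * t) * x')
      = χ ((a - a') * (s + (a + a') * t)) * (x * (starRingEnd ℂ) x') := by
  have : (a - a') * (s + (a + a') * t) = (a * s + a ^ 2 * t) + -(a' * s + a' ^ 2 * t) := by ring
  rw [this, hχ.mul (a * s + a ^ 2 * t), ← hχ.conj, map_mul]; ring

/-- admissible translations at level `k` for the whole tree -/
def Adm (p : ℕ) [Fact p.Prime] (j a0 k : ℕ) (s t : ℚ_[p]) : Prop :=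
  (∀ c, ‖s + 2 * cen p j a0 c * t‖ ≤ (p : ℝ) ^ (j + k)) ∧ ‖t‖ ≤ ((p : ℝ) ^ (j + k)) ^ 2

theorem Adm.mono {k l : ℕ} (hkl : k ≤ l) {s t : ℚ_[p]} (h : Adm p j a0 k s t) : Adm p j a0 l s t := by
  have hp1 := one_lt_p (p := p)
  have hle : (p : ℝ) ^ (j + k) ≤ (p : ℝ) ^ (j + l) := pow_le_pow_right₀ hp1.le (by omega)
  exact ⟨fun c => (h.1 c).trans hle, h.2.trans (by gcongr)⟩

theorem Fam.lv_inv (hf : Fam p χ j D a0 f) (hχ : IsChar p χ) {k l : ℕ} (hkl : k ≤ l)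
    {s t : ℚ_[p]} (hw : Adm p j a0 k s t) (z : ℚ_[p] × ℚ_[p])
    (hl : l ≤ D) (c : ℕ) :
    ‖lv p D Λ (vec f (z + (s, t))) l c‖ = ‖lv p D Λ (vec f z) l c‖ := by
  rw [hf.lv_eqv hχ hl c z s t ((hw.mono hkl).1 c) (hw.mono hkl).2, norm_mul, hχ.nrm, one_mul]

theorem Fam.trn_inv (hf : Fam p χ j D a0 f) (hχ : IsChar p χ) {k l : ℕ} (hkl : k ≤ l)
    {s t : ℚ_[p]} (hw : Adm p j a0 k s t) (z : ℚ_[p] × ℚ_[p])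
    (hl : l ≤ D) (c : ℕ) :
    ‖trn Λ (lv p D Λ (vec f (z + (s, t))) l c)‖ = ‖trn Λ (lv p D Λ (vec f z) l c)‖ := by
  rw [hf.trn_eqv hχ hl c z s t ((hw.mono hkl).1 c) (hw.mono hkl).2, norm_mul, hχ.nrm, one_mul]

theorem Fam.gg_inv (hf : Fam p χ j D a0 f) (hχ : IsChar p χ) {k l : ℕ} (hkl : k ≤ l)
    {s t : ℚ_[p]} (hw : Adm p j a0 k s t) (z : ℚ_[p] × ℚ_[p])
    (hl : l ≤ D) : gg p D Λ (vec f (z + (s, t))) l = gg p D Λ (vec f z) l := by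
  simp only [gg, hf.lv_inv hχ hkl hw z hl]

theorem Fam.hc_inv (hf : Fam p χ j D a0 f) (hχ : IsChar p χ) {k l : ℕ} (hkl : k ≤ l)
    {s t : ℚ_[p]} (hw : Adm p j a0 k s t) (z : ℚ_[p] × ℚ_[p])
    (hl : l < D) (c : ℕ) :
    hc p D Λ (vec f (z + (s, t))) l c = hc p D Λ (vec f z) l c := by
  simp only [hc, hf.lv_inv hχ hkl hw z hl.le, hf.trn_inv hχ (hkl.trans (Nat.le_succ l)) hw z hl]

theorem Fam.hh_inv (hf : Fam p χ j D a0 f) (hχ : IsChar p χ) {k l : ℕ} (hkl : k ≤ l)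
    {s t : ℚ_[p]} (hw : Adm p j a0 k s t) (z : ℚ_[p] × ℚ_[p])
    (hl : l < D) : hh p D Λ (vec f (z + (s, t))) l = hh p D Λ (vec f z) l := by
  simp only [hh, hf.hc_inv hχ hkl hw z hl]

theorem Fam.HH_inv (hf : Fam p χ j D a0 f) (hχ : IsChar p χ) {k l : ℕ} (hkl : k ≤ l)
    {s t : ℚ_[p]} (hw : Adm p j a0 k s t) (z : ℚ_[p] × ℚ_[p])
    : HH p D Λ (vec f (z + (s, t))) l = HH p D Λ (vec f z) l := by
  unfold HH
  refine Finset.sum_congr rfl fun n hn => ?_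
  rw [Finset.mem_Ico] at hn
  exact hf.hh_inv hχ (hkl.trans hn.1) hw z hn.2

theorem Fam.GG_inv (hf : Fam p χ j D a0 f) (hχ : IsChar p χ) {k l : ℕ} (hkl : k ≤ l)
    {s t : ℚ_[p]} (hw : Adm p j a0 k s t) (z : ℚ_[p] × ℚ_[p])
    (hl : l ≤ D) : GG p D Λ (vec f (z + (s, t))) l = GG p D Λ (vec f z) l := by
  unfold GG
  rw [hf.HH_inv hχ hkl hw z, hf.gg_inv hχ (hkl.trans hl) hw z le_rfl]


theorem Fam.EE_inv (hf : Fam p χ j D a0 f) (hχ : IsChar p χ) {k : ℕ} (hk : k ≤ D) {s t : ℚ_[p]}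
    (hw : Adm p j a0 k s t) (z : ℚ_[p] × ℚ_[p]) (lam : ℝ) :
    EE p D Λ lam (vec f (z + (s, t))) k ↔ EE p D Λ lam (vec f z) k := by
  unfold EE
  rw [hf.GG_inv hχ le_rfl hw z hk]
  refine and_congr Iff.rfl (forall_congr' fun l => ?_)
  refine forall_congr' fun hl => forall_congr' fun hlD => ?_
  rw [hf.GG_inv hχ hl.le hw z hlD]


theorem adm_horizontal {k : ℕ} {s : ℚ_[p]} (hs : ‖s‖ ≤ (p : ℝ) ^ (j + k)) : Adm p j a0 k s 0 := by
  refine ⟨fun c => by simpa using hs, ?_⟩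
  simp only [norm_zero]; positivity

/-- an element with prescribed product, `‖x₀ / y‖` bounded -/
theorem div_bound {x0 y : ℚ_[p]} {B : ℝ} (hx0 : ‖x0‖ ≤ p) (hy : (p : ℝ) ≤ ‖y‖ * B) :
    y ≠ 0 ∧ ‖x0 / y‖ ≤ B := by
  have hp1 := one_lt_p (p := p)
  have hy0 : y ≠ 0 := by
    rintro rfl; rw [norm_zero, zero_mul] at hy; linarith
  refine ⟨hy0, ?_⟩
  rw [norm_div, div_le_iff₀ (norm_pos_iff.2 hy0), mul_comm]
  exact hx0.trans hy

theorem integral_ofReal_eq_zero {X : Type*} [MeasurableSpace X] {ν : Measure X} {φ : X → ℝ}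
    (h : ∫ z, ((φ z : ℝ) : ℂ) ∂ν = 0) : ∫ z, φ z ∂ν = 0 := by
  rw [integral_complex_ofReal] at h
  exact_mod_cast h

/-- Orthogonality of the high part at level `l` to anything invariant at scale `l + 1`. -/
theorem Fam.orth_scale (hf : Fam p χ j D a0 f) (hχ : IsChar p χ) {l : ℕ} (hl : l < D)
    (Ψ : (ℕ → ℂ) → ℝ)
    (hΨ : ∀ z s, ‖s‖ ≤ (p : ℝ) ^ (j + (l + 1)) → Ψ (vec f (z + (s, 0))) = Ψ (vec f z)) :
    ∫ z, Ψ (vec f z) * hh p D Λ (vec f z) l ∂(μ.prod μ) = 0 := by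
  obtain ⟨x0, hx0, hx1⟩ := hχ.nontriv
  have hp1 := one_lt_p (p := p)
  apply integral_ofReal_eq_zero
  have e : ∀ z, ((Ψ (vec f z) * hh p D Λ (vec f z) l : ℝ) : ℂ)
      = ∑ c ∈ Finset.range (p ^ l), ∑ i ∈ Finset.range p, ∑ i' ∈ (Finset.range p).erase i,
        (Ψ (vec f z) : ℂ) * (trn Λ (lv p D Λ (vec f z) (l + 1) (c + i * p ^ l)) *
        (starRingEnd ℂ) (trn Λ (lv p D Λ (vec f z) (l + 1) (c + i' * p ^ l)))) := by
    intro z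
    unfold hh
    push_cast
    simp only [hc_ofReal hl, Finset.mul_sum]
  simp only [e]
  have hIntg : ∀ c i i', Integrable (fun z => (Ψ (vec f z) : ℂ) *
      (trn Λ (lv p D Λ (vec f z) (l + 1) (c + i * p ^ l)) *
        (starRingEnd ℂ) (trn Λ (lv p D Λ (vec f z) (l + 1) (c + i' * p ^ l))))) (μ.prod μ) := by
    intro c i i'
    exact hf.integrable μ hχ (fun v => (Ψ v : ℂ) *
      (trn Λ (lv p D Λ v (l + 1) (c + i * p ^ l)) *
        (starRingEnd ℂ) (trn Λ (lv p D Λ v (l + 1) (c + i' * p ^ l))))) (by simp [lv_zero, trn_zero])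
  rw [integral_finsetSum _ fun c _ => integrable_finsetSum _ fun i _ =>
    integrable_finsetSum _ fun i' _ => hIntg c i i']
  refine Finset.sum_eq_zero fun c hc => ?_
  rw [integral_finsetSum _ fun i _ => integrable_finsetSum _ fun i' _ => hIntg c i i']
  refine Finset.sum_eq_zero fun i hi => ?_
  rw [integral_finsetSum _ fun i' _ => hIntg c i i']
  refine Finset.sum_eq_zero fun i' hi' => ?_
  rw [Finset.mem_range] at hc hi
  rw [Finset.mem_erase, Finset.mem_range] at hi'
  have hlt : ∀ e < p, c + e * p ^ l < p ^ (l + 1) := by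
    intro e he
    calc c + e * p ^ l < p ^ l + e * p ^ l := by omega
      _ = (e + 1) * p ^ l := by ring
      _ ≤ p * p ^ l := Nat.mul_le_mul_right _ he
      _ = _ := by ring
  have hne : c + i * p ^ l ≠ c + i' * p ^ l := by
    intro h
    have h3 : i * p ^ l = i' * p ^ l := by omega
    exact hi'.1 (Nat.eq_of_mul_eq_mul_right (pow_pos hp.out.pos l) h3).symm
  have hfar := cen_far (p := p) (j := j) (a0 := a0) (hlt i hi) (hlt i' hi'.2) hne
  set a := cen p j a0 (c + i * p ^ l)
  set a' := cen p j a0 (c + i' * p ^ l)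
  obtain ⟨hy0, hs⟩ := div_bound hx0 hfar
  have hadm : Adm p j a0 (l + 1) (x0 / (a - a')) 0 := adm_horizontal hs
  refine vanish μ (x0 / (a - a'), 0) (χ x0) hx1 fun z => ?_
  rw [hΨ z _ hs, hf.trn_eqv hχ hl _ z _ _ (hadm.1 _) hadm.2,
    hf.trn_eqv hχ hl _ z _ _ (hadm.1 _) hadm.2, pair_char hχ]
  have : (a - a') * (x0 / (a - a') + (a + a') * 0) = x0 := by field_simp; ring
  rw [this]; ring

/-- Orthogonality of high parts of distinct intervals at the same level. -/
theorem Fam.orth_node (hf : Fam p χ j D a0 f) (hχ : IsChar p χ) (h2 : p ≠ 2) {l : ℕ} (hl : l < D)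
    {c d : ℕ} (hcl : c < p ^ l) (hdl : d < p ^ l) (hcd : c ≠ d) :
    ∫ z, hc p D Λ (vec f z) l c * hc p D Λ (vec f z) l d ∂(μ.prod μ) = 0 := by
  obtain ⟨x0, hx0, hx1⟩ := hχ.nontriv
  have hp1 := one_lt_p (p := p)
  apply integral_ofReal_eq_zero
  let P : (ℕ → ℂ) → ℕ → ℕ → ℂ := fun v c i => trn Λ (lv p D Λ v (l + 1) (c + i * p ^ l))
  have e : ∀ z, ((hc p D Λ (vec f z) l c * hc p D Λ (vec f z) l d : ℝ) : ℂ)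
      = ∑ i ∈ Finset.range p, ∑ i' ∈ (Finset.range p).erase i,
        ∑ e ∈ Finset.range p, ∑ e' ∈ (Finset.range p).erase e,
        (P (vec f z) c i * (starRingEnd ℂ) (P (vec f z) c i')) *
          (P (vec f z) d e * (starRingEnd ℂ) (P (vec f z) d e')) := by
    intro z
    push_cast
    rw [hc_ofReal hl, hc_ofReal hl, Finset.sum_mul]
    refine Finset.sum_congr rfl fun i _ => ?_
    rw [Finset.sum_mul]
    refine Finset.sum_congr rfl fun i' _ => ?_
    rw [Finset.mul_sum]
    refine Finset.sum_congr rfl fun e _ => ?_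
    rw [Finset.mul_sum]
  simp only [e]
  have hIntg : ∀ i i' e e', Integrable (fun z =>
      (P (vec f z) c i * (starRingEnd ℂ) (P (vec f z) c i')) *
          (P (vec f z) d e * (starRingEnd ℂ) (P (vec f z) d e'))) (μ.prod μ) := by
    intro i i' e e'
    exact hf.integrable μ hχ (fun v => (P v c i * (starRingEnd ℂ) (P v c i')) *
          (P v d e * (starRingEnd ℂ) (P v d e'))) (by simp [P, lv_zero, trn_zero])
  rw [integral_finsetSum _ fun i _ => integrable_finsetSum _ fun i' _ =>
    integrable_finsetSum _ fun e _ => integrable_finsetSum _ fun e' _ => hIntg i i' e e']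
  refine Finset.sum_eq_zero fun i hi => ?_
  rw [integral_finsetSum _ fun i' _ =>
    integrable_finsetSum _ fun e _ => integrable_finsetSum _ fun e' _ => hIntg i i' e e']
  refine Finset.sum_eq_zero fun i' hi' => ?_
  rw [integral_finsetSum _ fun e _ => integrable_finsetSum _ fun e' _ => hIntg i i' e e']
  refine Finset.sum_eq_zero fun e he => ?_
  rw [integral_finsetSum _ fun e' _ => hIntg i i' e e']
  refine Finset.sum_eq_zero fun e' he' => ?_
  rw [Finset.mem_range] at hi he
  rw [Finset.mem_erase, Finset.mem_range] at hi' he'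
  have hlt : ∀ e < p, c + e * p ^ l < p ^ (l + 1) := by
    intro e he
    calc c + e * p ^ l < p ^ l + e * p ^ l := by omega
      _ = (e + 1) * p ^ l := by ring
      _ ≤ p * p ^ l := Nat.mul_le_mul_right _ he
      _ = _ := by ring
  have hne : c + i * p ^ l ≠ c + i' * p ^ l := by
    intro h
    have h3 : i * p ^ l = i' * p ^ l := by omega
    exact hi'.1 (Nat.eq_of_mul_eq_mul_right (pow_pos hp.out.pos l) h3).symm
  have hfar := cen_far (p := p) (j := j) (a0 := a0) (hlt i hi) (hlt i' hi'.2) hne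
  have hfar2 := cen_far (p := p) (j := j) (a0 := a0) hcl hdl hcd
  have ha1 := cen_child (p := p) (j := j) (a0 := a0) c i l
  have ha2 := cen_child (p := p) (j := j) (a0 := a0) c i' l
  have hb1 := cen_child (p := p) (j := j) (a0 := a0) d e l
  have hb2 := cen_child (p := p) (j := j) (a0 := a0) d e' l
  set a := cen p j a0 c
  set b := cen p j a0 d
  set a1 := cen p j a0 (c + i * p ^ l)
  set a2 := cen p j a0 (c + i' * p ^ l)
  set b1 := cen p j a0 (d + e * p ^ l)
  set b2 := cen p j a0 (d + e' * p ^ l)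
  set Q : ℝ := (p : ℝ) ^ (j + l) with hQ
  have hQ0 : 0 < Q := by positivity
  have hQ1 : 1 ≤ Q := one_le_ppow _
  have hQs : (p : ℝ) ^ (j + (l + 1)) = Q * p := by rw [hQ]; ring
  rw [hQs] at hfar
  have hfar1 : 1 ≤ ‖a1 - a2‖ * Q := by nlinarith
  have hab : Q⁻¹ < ‖a - b‖ := by
    rw [inv_lt_iff_one_lt_mul₀' hQ0]; nlinarith
  have n2 := norm_two (p := p) h2
  -- norms
  have hA : ∀ x y : ℚ_[p], ‖x - a‖ ≤ Q⁻¹ → ‖y - a‖ ≤ Q⁻¹ → ‖x + y - 2 * b‖ = ‖a - b‖ := by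
    intro x y hx hy
    have h3 : x + y - 2 * b = 2 * (a - b) + ((x - a) + (y - a)) := by ring
    have h4 : ‖(x - a) + (y - a)‖ < ‖2 * (a - b)‖ := by
      rw [norm_mul, n2, one_mul]; exact (norm_add_le_of hx hy).trans_lt hab
    rw [h3, Padic.add_eq_max_of_ne h4.ne', max_eq_left h4.le, norm_mul, n2, one_mul]
  have hsum := hA a1 a2 ha1 ha2
  have hy : (p : ℝ) ≤ ‖(a1 - a2) * (a1 + a2 - 2 * b)‖ * (Q * Q) := by
    rw [norm_mul, hsum]
    calc (p : ℝ) ≤ 1 * (‖a - b‖ * Q) := by rw [one_mul]; exact hfar2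
      _ ≤ (‖a1 - a2‖ * Q) * (‖a - b‖ * Q) := by gcongr
      _ = _ := by ring
  have hy' : (p : ℝ) ≤ ‖(a1 - a2) * (a1 + a2 - 2 * b)‖ * (Q * p / ‖a - b‖) := by
    have hab0 : 0 < ‖a - b‖ := (inv_pos.2 hQ0).trans hab
    rw [norm_mul, hsum]
    have : ‖a1 - a2‖ * ‖a - b‖ * (Q * p / ‖a - b‖) = (‖a1 - a2‖ * Q) * p := by field_simp
    rw [this]; nlinarith
  obtain ⟨hy0, ht⟩ := div_bound hx0 hy
  obtain ⟨-, ht'⟩ := div_bound hx0 hy'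
  set t := x0 / ((a1 - a2) * (a1 + a2 - 2 * b)) with htdef
  have htQ : ‖t‖ ≤ ((p : ℝ) ^ (j + (l + 1))) ^ 2 := by
    rw [hQs]
    calc ‖t‖ ≤ Q * Q := ht
      _ ≤ (Q * p) * (Q * p) := by gcongr <;> nlinarith
      _ = _ := by ring
  have hbc : ∀ y : ℚ_[p], ‖y - b‖ ≤ Q⁻¹ → ‖-2 * b * t + 2 * y * t‖ ≤ (p : ℝ) ^ (j + (l + 1)) := by
    intro y hy
    have : -2 * b * t + 2 * y * t = 2 * (y - b) * t := by ring
    rw [this, norm_mul, norm_mul, n2, one_mul, hQs]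
    calc ‖y - b‖ * ‖t‖ ≤ Q⁻¹ * (Q * Q) := by gcongr
      _ = Q * 1 := by field_simp
      _ ≤ _ := by gcongr
  have hac : ∀ y : ℚ_[p], ‖y - a‖ ≤ Q⁻¹ → ‖-2 * b * t + 2 * y * t‖ ≤ (p : ℝ) ^ (j + (l + 1)) := by
    intro y hy
    have : -2 * b * t + 2 * y * t = (y + y - 2 * b) * t := by ring
    rw [this, norm_mul, hA y y hy hy, hQs]
    have hab0 : 0 < ‖a - b‖ := (inv_pos.2 hQ0).trans hab
    calc ‖a - b‖ * ‖t‖ ≤ ‖a - b‖ * (Q * p / ‖a - b‖) := by gcongr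
      _ = _ := by field_simp
  refine vanish μ (-2 * b * t, t) (χ x0) hx1 fun z => ?_
  simp only [P]
  rw [hf.trn_eqv hχ hl (c + i * p ^ l) z _ _ (hac a1 ha1) htQ,
    hf.trn_eqv hχ hl (c + i' * p ^ l) z _ _ (hac a2 ha2) htQ,
    hf.trn_eqv hχ hl (d + e * p ^ l) z _ _ (hbc b1 hb1) htQ,
    hf.trn_eqv hχ hl (d + e' * p ^ l) z _ _ (hbc b2 hb2) htQ, pair_char hχ, pair_char hχ]
  have e1 : (a1 - a2) * (-2 * b * t + (a1 + a2) * t) = x0 := by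
    have : (a1 - a2) * (-2 * b * t + (a1 + a2) * t) = ((a1 - a2) * (a1 + a2 - 2 * b)) * t := by ring
    rw [this, htdef, mul_div_cancel₀ _ hy0]
  have e2 : χ ((b1 - b2) * (-2 * b * t + (b1 + b2) * t)) = 1 := by
    apply hχ.triv
    have : (b1 - b2) * (-2 * b * t + (b1 + b2) * t) = ((b1 - b) ^ 2 - (b2 - b) ^ 2) * t := by ring
    rw [this, norm_mul]
    have h5 : ‖(b1 - b) ^ 2 - (b2 - b) ^ 2‖ ≤ (Q⁻¹) ^ 2 := by
      apply norm_sub_le_of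
      · rw [norm_pow]; gcongr
      · rw [norm_pow]; gcongr
    calc _ ≤ (Q⁻¹) ^ 2 * (Q * Q) := by gcongr
      _ = 1 := by field_simp
  rw [e1, e2]; ring


theorem Fam.bil_vanish (hf : Fam p χ j D a0 f) (hχ : IsChar p χ) (h2 : p ≠ 2) {k : ℕ} (hk : k ≤ D)
    (ω : (ℕ → ℂ) → ℝ)
    (hω : ∀ z s t, Adm p j a0 k s t → ω (vec f (z + (s, t))) = ω (vec f z))
    {c1 c2 d1 d2 : ℕ} (hc1 : c1 < p ^ k) (hc2 : c2 < p ^ k) (hne : c1 ≠ c2)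
    (hcc : c1 % p = c2 % p) (hdd : d1 % p = d2 % p) (hcd : c1 % p ≠ d1 % p) :
    ∫ z, (ω (vec f z) : ℂ) *
      ((lv p D Λ (vec f z) k c1 * (starRingEnd ℂ) (lv p D Λ (vec f z) k c2)) *
       (lv p D Λ (vec f z) k d1 * (starRingEnd ℂ) (lv p D Λ (vec f z) k d2))) ∂(μ.prod μ) = 0 := by
  obtain ⟨x0, hx0, hx1⟩ := hχ.nontriv
  have hp1 := one_lt_p (p := p)
  have hfar := cen_far (p := p) (j := j) (a0 := a0) hc1 hc2 hne
  have hfar2 := cen_far' (p := p) (j := j) (a0 := a0) (c := c1) (c' := d1) (n := 1) (by simpa using hcd)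
  have hcl1 := cen_close (p := p) (j := j) (a0 := a0) (c := c2) (c' := c1) (n := 1)
    (by simpa using hcc.symm)
  have hcl2 := cen_close (p := p) (j := j) (a0 := a0) (c := d1) (c' := d2) (n := 1)
    (by simpa using hdd)
  have hr1 := fun c => cen_root (p := p) (j := j) (a0 := a0) c d1
  have hr2 := fun c => cen_root (p := p) (j := j) (a0 := a0) c d2
  set a1 := cen p j a0 c1 with ha1
  set a2 := cen p j a0 c2 with ha2
  set b1 := cen p j a0 d1 with hb1
  set b2 := cen p j a0 d2 with hb2
  set Q : ℝ := (p : ℝ) ^ (j + k) with hQ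
  set P : ℝ := (p : ℝ) ^ j with hP
  have hQ0 : 0 < Q := by positivity
  have hP0 : 0 < P := by positivity
  have hPQ : P ≤ Q := pow_le_pow_right₀ hp1.le (by omega)
  have hPs : (p : ℝ) ^ (j + 1) = P * p := by rw [hP]; ring
  have n2 := norm_two (p := p) h2
  rw [hPs] at hfar2 hcl1 hcl2
  have hf2 : 1 ≤ ‖a1 - b1‖ * P := by nlinarith
  have hsum : ‖a1 + a2 - b1 - b2‖ = ‖a1 - b1‖ := by
    have h3 : a1 + a2 - b1 - b2 = 2 * (a1 - b1) + ((a2 - a1) + (b1 - b2)) := by ring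
    have h4 : ‖(a2 - a1) + (b1 - b2)‖ < ‖2 * (a1 - b1)‖ := by
      rw [norm_mul, n2, one_mul]
      refine (norm_add_le_of hcl1 hcl2).trans_lt ?_
      rw [inv_lt_iff_one_lt_mul₀' (by positivity)]
      nlinarith
    rw [h3, Padic.add_eq_max_of_ne h4.ne', max_eq_left h4.le, norm_mul, n2, one_mul]
  have hy : (p : ℝ) ≤ ‖(a1 - a2) * (a1 + a2 - b1 - b2)‖ * (Q * P) := by
    rw [norm_mul, hsum]
    calc (p : ℝ) ≤ (‖a1 - a2‖ * Q) * 1 := by rw [mul_one]; exact hfar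
      _ ≤ (‖a1 - a2‖ * Q) * (‖a1 - b1‖ * P) := by gcongr
      _ = _ := by ring
  obtain ⟨hy0, ht⟩ := div_bound hx0 hy
  set t := x0 / ((a1 - a2) * (a1 + a2 - b1 - b2)) with htdef
  have hadm : Adm p j a0 k (-(b1 + b2) * t) t := by
    constructor
    · intro c
      have : -(b1 + b2) * t + 2 * cen p j a0 c * t
          = ((cen p j a0 c - b1) + (cen p j a0 c - b2)) * t := by ring
      rw [this, norm_mul]
      calc _ ≤ P⁻¹ * (Q * P) := by
            gcongr
            exact norm_add_le_of (hr1 c) (hr2 c)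
        _ = Q := by field_simp
    · calc ‖t‖ ≤ Q * P := ht
        _ ≤ Q * Q := by gcongr
        _ = _ := by ring
  refine vanish μ (-(b1 + b2) * t, t) (χ x0) hx1 fun z => ?_
  rw [hω z _ _ hadm, hf.lv_eqv hχ hk c1 z _ _ (hadm.1 _) hadm.2,
    hf.lv_eqv hχ hk c2 z _ _ (hadm.1 _) hadm.2, hf.lv_eqv hχ hk d1 z _ _ (hadm.1 _) hadm.2,
    hf.lv_eqv hχ hk d2 z _ _ (hadm.1 _) hadm.2, pair_char hχ, pair_char hχ,
    ← ha1, ← ha2, ← hb1, ← hb2]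
  have e1 : (a1 - a2) * (-(b1 + b2) * t + (a1 + a2) * t) = x0 := by
    have : (a1 - a2) * (-(b1 + b2) * t + (a1 + a2) * t)
        = ((a1 - a2) * (a1 + a2 - b1 - b2)) * t := by ring
    rw [this, htdef, mul_div_cancel₀ _ hy0]
  have e2 : (b1 - b2) * (-(b1 + b2) * t + (b1 + b2) * t) = 0 := by ring
  rw [e1, e2, hχ.triv 0 (by simp)]; ring

theorem quad_expand (I I' : Finset ℕ) (u : ℕ → ℂ) :
    ((‖∑ c ∈ I, u c‖ ^ 2 * ‖∑ c ∈ I', u c‖ ^ 2 : ℝ) : ℂ)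
      = ∑ x ∈ (I ×ˢ I) ×ˢ (I' ×ˢ I'), (u x.1.1 * (starRingEnd ℂ) (u x.1.2)) *
          (u x.2.1 * (starRingEnd ℂ) (u x.2.2)) := by
  have key : ∀ J : Finset ℕ, ((‖∑ c ∈ J, u c‖ ^ 2 : ℝ) : ℂ)
      = ∑ x ∈ J ×ˢ J, u x.1 * (starRingEnd ℂ) (u x.2) := by
    intro J
    rw [← Complex.normSq_eq_norm_sq, ← Complex.mul_conj, map_sum, Finset.sum_mul_sum,
      ← Finset.sum_product']
  rw [Complex.ofReal_mul, key, key, Finset.sum_mul_sum, ← Finset.sum_product']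

theorem quad_diag (I I' : Finset ℕ) (u : ℕ → ℂ) :
    (((∑ c ∈ I, ‖u c‖ ^ 2) * ∑ c ∈ I', ‖u c‖ ^ 2 : ℝ) : ℂ)
      = ∑ x ∈ (I ×ˢ I) ×ˢ (I' ×ˢ I'), if x.1.1 = x.1.2 ∧ x.2.1 = x.2.2 then
        (u x.1.1 * (starRingEnd ℂ) (u x.1.2)) * (u x.2.1 * (starRingEnd ℂ) (u x.2.2)) else 0 := by
  have key : ∀ J : Finset ℕ, ((∑ c ∈ J, ‖u c‖ ^ 2 : ℝ) : ℂ)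
      = ∑ x ∈ J ×ˢ J, if x.1 = x.2 then u x.1 * (starRingEnd ℂ) (u x.2) else 0 := by
    intro J
    rw [Finset.sum_product, Complex.ofReal_sum]
    refine Finset.sum_congr rfl fun x hx => ?_
    rw [Finset.sum_ite_eq, if_pos hx, Complex.mul_conj, Complex.normSq_eq_norm_sq]
  rw [Complex.ofReal_mul, key, key, Finset.sum_mul_sum, ← Finset.sum_product']
  refine Finset.sum_congr rfl fun x _ => ?_
  by_cases h1 : x.1.1 = x.1.2 <;> by_cases h2 : x.2.1 = x.2.2 <;> simp [h1, h2]

/-- Local bilinear estimate. -/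
theorem Fam.bilinear (hf : Fam p χ j D a0 f) (hχ : IsChar p χ) (h2 : p ≠ 2) {k : ℕ}
    (hkD : k ≤ D) (ω : (ℕ → ℂ) → ℝ) (hω0 : ∀ v, 0 ≤ ω v)
    (hω : ∀ z s t, Adm p j a0 k s t → ω (vec f (z + (s, t))) = ω (vec f z))
    {i i' : ℕ} (hii : i ≠ i') :
    ∫ z, ω (vec f z) * (‖AA p D Λ (vec f z) k i‖ ^ 2 * ‖AA p D Λ (vec f z) k i'‖ ^ 2) ∂(μ.prod μ)
      ≤ ∫ z, ω (vec f z) * gg p D Λ (vec f z) k ^ 2 ∂(μ.prod μ) := by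
  set I := (Finset.range (p ^ k)).filter (fun c => c % p = i) with hI
  set I' := (Finset.range (p ^ k)).filter (fun c => c % p = i') with hI'
  let T : (ℕ × ℕ) × (ℕ × ℕ) → (ℕ → ℂ) → ℂ := fun x v => (ω v : ℂ) *
      ((lv p D Λ v k x.1.1 * (starRingEnd ℂ) (lv p D Λ v k x.1.2)) *
       (lv p D Λ v k x.2.1 * (starRingEnd ℂ) (lv p D Λ v k x.2.2)))
  have hIntg : ∀ x, Integrable (fun z => T x (vec f z)) (μ.prod μ) := fun x =>
    hf.integrable μ hχ (T x) (by simp [T, lv_zero])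
  have key : ∫ z, ω (vec f z) * (‖AA p D Λ (vec f z) k i‖ ^ 2 * ‖AA p D Λ (vec f z) k i'‖ ^ 2)
        ∂(μ.prod μ)
      = ∫ z, ω (vec f z) * ((∑ c ∈ I, ‖lv p D Λ (vec f z) k c‖ ^ 2) *
          ∑ c ∈ I', ‖lv p D Λ (vec f z) k c‖ ^ 2) ∂(μ.prod μ) := by
    rw [← Complex.ofReal_inj, ← integral_complex_ofReal, ← integral_complex_ofReal]
    have e1 : ∀ z, ((ω (vec f z) * (‖AA p D Λ (vec f z) k i‖ ^ 2 *
        ‖AA p D Λ (vec f z) k i'‖ ^ 2) : ℝ) : ℂ)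
        = ∑ x ∈ (I ×ˢ I) ×ˢ (I' ×ˢ I'), T x (vec f z) := by
      intro z
      rw [Complex.ofReal_mul]
      unfold AA
      rw [quad_expand, Finset.mul_sum]
    have e2 : ∀ z, ((ω (vec f z) * ((∑ c ∈ I, ‖lv p D Λ (vec f z) k c‖ ^ 2) *
          ∑ c ∈ I', ‖lv p D Λ (vec f z) k c‖ ^ 2) : ℝ) : ℂ)
        = ∑ x ∈ (I ×ˢ I) ×ˢ (I' ×ˢ I'),
          if x.1.1 = x.1.2 ∧ x.2.1 = x.2.2 then T x (vec f z) else 0 := by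
      intro z
      rw [Complex.ofReal_mul, quad_diag, Finset.mul_sum]
      refine Finset.sum_congr rfl fun x _ => ?_
      rw [mul_ite, mul_zero]
    simp only [e1, e2]
    rw [integral_finsetSum _ fun x _ => hIntg x, integral_finsetSum _ fun x _ => ?_]
    · refine Finset.sum_congr rfl fun x hx => ?_
      split_ifs with hx2
      · rfl
      · rw [integral_zero]
        simp only [hI, hI', Finset.mem_product, Finset.mem_filter, Finset.mem_range] at hx
        obtain ⟨⟨⟨h1, h1'⟩, h3, h3'⟩, ⟨h4, h4'⟩, h5, h5'⟩ := hx
        by_cases h6 : x.1.1 = x.1.2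
        · have h7 : x.2.1 ≠ x.2.2 := fun h => hx2 ⟨h6, h⟩
          rw [← hf.bil_vanish (Λ := Λ) μ hχ h2 hkD ω hω h4 h5 h7 (h4'.trans h5'.symm)
            (h1'.trans h3'.symm) (by rw [h4', h1']; exact hii.symm)]
          refine integral_congr_ae (.of_forall fun z => ?_)
          simp only [T]
          ring
        · exact hf.bil_vanish μ hχ h2 hkD ω hω h1 h3 h6 (h1'.trans h3'.symm)
            (h4'.trans h5'.symm) (by rw [h4', h1']; exact hii)
    · split_ifs
      · exact hIntg x
      · exact integrable_zero _ _ _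
  rw [key]
  have hsub : ∀ z (J : Finset ℕ), J ⊆ Finset.range (p ^ k) →
      ∑ c ∈ J, ‖lv p D Λ (vec f z) k c‖ ^ 2 ≤ gg p D Λ (vec f z) k := fun z J hJ =>
    Finset.sum_le_sum_of_subset_of_nonneg hJ fun _ _ _ => by positivity
  refine integral_mono ?_ ?_ fun z => ?_
  · exact hf.integrable μ hχ (fun v => ω v * ((∑ c ∈ I, ‖lv p D Λ v k c‖ ^ 2) *
          ∑ c ∈ I', ‖lv p D Λ v k c‖ ^ 2)) (by simp [lv_zero])
  · exact hf.integrable μ hχ (fun v => ω v * gg p D Λ v k ^ 2) (by simp [gg_zero])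
  · have h1 := hsub z I (Finset.filter_subset _ _)
    have h3 := hsub z I' (Finset.filter_subset _ _)
    have h4 : 0 ≤ ∑ c ∈ I', ‖lv p D Λ (vec f z) k c‖ ^ 2 :=
      Finset.sum_nonneg fun _ _ => by positivity
    refine mul_le_mul_of_nonneg_left ?_ (hω0 _)
    rw [sq]
    exact mul_le_mul h1 h3 h4 (gg_nonneg _)


theorem Fam.hh_integral (hf : Fam p χ j D a0 f) (hχ : IsChar p χ) {l : ℕ} (hl : l < D) :
    ∫ z, hh p D Λ (vec f z) l ∂(μ.prod μ) = 0 := by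
  have := hf.orth_scale (Λ := Λ) μ hχ hl (fun _ => 1) (fun _ _ _ => rfl)
  simpa using this

theorem Fam.GG_integral (hf : Fam p χ j D a0 f) (hχ : IsChar p χ) (n : ℕ) :
    ∫ z, GG p D Λ (vec f z) n ∂(μ.prod μ) = ∫ z, gg p D Λ (vec f z) D ∂(μ.prod μ) := by
  unfold GG HH
  rw [integral_add, integral_finsetSum]
  · rw [Finset.sum_eq_zero, add_zero]
    intro l hl
    exact hf.hh_integral μ hχ (Finset.mem_Ico.1 hl).2
  · intro l _
    exact hf.integrable μ hχ (fun v => hh p D Λ v l) (hh_zero _)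
  · exact hf.integrable μ hχ (fun v => gg p D Λ v D) (gg_zero _)
  · exact integrable_finsetSum _ fun l _ => hf.integrable μ hχ (fun v => hh p D Λ v l) (hh_zero _)

theorem Fam.hh_sq (hf : Fam p χ j D a0 f) (hχ : IsChar p χ) (h2 : p ≠ 2) (hΛ : 0 ≤ Λ)
    {l : ℕ} (hl : l < D) :
    ∫ z, hh p D Λ (vec f z) l ^ 2 ∂(μ.prod μ)
      ≤ (p : ℝ) ^ 3 * Λ ^ 2 * ∫ z, gg p D Λ (vec f z) D ∂(μ.prod μ) := by
  have hIntg : ∀ c d, Integrable (fun z => hc p D Λ (vec f z) l c * hc p D Λ (vec f z) l d)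
      (μ.prod μ) := fun c d =>
    hf.integrable μ hχ (fun v => hc p D Λ v l c * hc p D Λ v l d) (by simp [hc_zero])
  have e : ∫ z, hh p D Λ (vec f z) l ^ 2 ∂(μ.prod μ)
      = ∫ z, ∑ c ∈ Finset.range (p ^ l), hc p D Λ (vec f z) l c ^ 2 ∂(μ.prod μ) := by
    have e1 : ∀ z, hh p D Λ (vec f z) l ^ 2 = ∑ c ∈ Finset.range (p ^ l),
        ∑ d ∈ Finset.range (p ^ l), hc p D Λ (vec f z) l c * hc p D Λ (vec f z) l d := by
      intro z; unfold hh; rw [sq, Finset.sum_mul_sum]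
    simp only [e1, sq]
    rw [integral_finsetSum _ fun c _ => integrable_finsetSum _ fun d _ => hIntg c d,
      integral_finsetSum _ fun c _ => hIntg c c]
    refine Finset.sum_congr rfl fun c hcm => ?_
    rw [integral_finsetSum _ fun d _ => hIntg c d, Finset.sum_eq_single_of_mem c hcm]
    intro d hd hdc
    exact hf.orth_node μ hχ h2 hl (Finset.mem_range.1 hcm) (Finset.mem_range.1 hd) hdc.symm
  rw [e, ← hf.GG_integral (Λ := Λ) μ hχ (l + 1), ← integral_const_mul]
  refine integral_mono ?_ ?_ fun z => ?_
  · exact hf.integrable μ hχ (fun v => ∑ c ∈ Finset.range (p ^ l), hc p D Λ v l c ^ 2)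
      (by simp [hc_zero])
  · exact hf.integrable μ hχ (fun v => (p : ℝ) ^ 3 * Λ ^ 2 * GG p D Λ v (l + 1)) (by simp [GG_zero])
  · have h3 : ∑ c ∈ Finset.range (p ^ l), hc p D Λ (vec f z) l c ^ 2
        ≤ (p : ℝ) ^ 3 * Λ ^ 2 * pp p D Λ (vec f z) (l + 1) := by
      unfold pp
      rw [sum_split, Finset.mul_sum]
      exact Finset.sum_le_sum fun c _ => hc_sq_le hp.out.one_le hΛ hl c
    refine h3.trans ?_
    have h4 := pp_le_gg (q := p) (D := D) (Λ := Λ) (v := vec f z) (l + 1)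
    have h5 := gg_le_GG (q := p) (Λ := Λ) (v := vec f z) (show l + 1 ≤ D from hl)
    exact mul_le_mul_of_nonneg_left (h4.trans h5) (by positivity)

theorem Fam.HH_sq (hf : Fam p χ j D a0 f) (hχ : IsChar p χ) (h2 : p ≠ 2) (hΛ : 0 ≤ Λ)
    {n : ℕ} (hn : n ≤ D) :
    ∫ z, HH p D Λ (vec f z) n ^ 2 ∂(μ.prod μ)
      ≤ ((D : ℝ) - n) * ((p : ℝ) ^ 3 * Λ ^ 2 * ∫ z, gg p D Λ (vec f z) D ∂(μ.prod μ)) := by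
  induction hn using Nat.decreasingInduction with
  | self => simp [HH]
  | of_succ n hn ih =>
    have hcross : ∫ z, HH p D Λ (vec f z) (n + 1) * hh p D Λ (vec f z) n ∂(μ.prod μ) = 0 :=
      hf.orth_scale μ hχ hn (fun v => HH p D Λ v (n + 1)) fun z s hs =>
        hf.HH_inv hχ le_rfl (adm_horizontal hs) z
    have e : ∀ z, HH p D Λ (vec f z) n ^ 2 = hh p D Λ (vec f z) n ^ 2 +
        (2 * (HH p D Λ (vec f z) (n + 1) * hh p D Λ (vec f z) n)
          + HH p D Λ (vec f z) (n + 1) ^ 2) := by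
      intro z; rw [HH_step hn]; ring
    have i1 := hf.integrable μ hχ (fun v => hh p D Λ v n ^ 2) (by simp [hh_zero])
    have i2 := hf.integrable μ hχ (fun v => 2 * (HH p D Λ v (n + 1) * hh p D Λ v n))
      (by simp [hh_zero])
    have i3 := hf.integrable μ hχ (fun v => HH p D Λ v (n + 1) ^ 2) (by simp [HH_zero])
    have i23 : Integrable (fun z => 2 * (HH p D Λ (vec f z) (n + 1) * hh p D Λ (vec f z) n)
          + HH p D Λ (vec f z) (n + 1) ^ 2) (μ.prod μ) := i2.add i3
    simp only [e]
    rw [integral_add i1 i23, integral_add i2 i3, integral_const_mul, hcross]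
    have h3 := hf.hh_sq (Λ := Λ) μ hχ h2 hΛ hn
    push_cast at ih
    linarith

open scoped Classical in
/-- indicator of `EE` -/
noncomputable def ind (q D : ℕ) (Λ lam : ℝ) (k : ℕ) (v : ℕ → ℂ) : ℝ :=
  if EE q D Λ lam v k then 1 else 0

theorem ind_nonneg (q D : ℕ) (Λ lam : ℝ) (k : ℕ) (v : ℕ → ℂ) : 0 ≤ ind q D Λ lam k v := by
  unfold ind; split_ifs <;> norm_num

theorem Fam.ind_inv (hf : Fam p χ j D a0 f) (hχ : IsChar p χ) {k : ℕ} (hk : k ≤ D) {s t : ℚ_[p]}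
    (hw : Adm p j a0 k s t) (z : ℚ_[p] × ℚ_[p]) (lam : ℝ) :
    ind p D Λ lam k (vec f (z + (s, t))) = ind p D Λ lam k (vec f z) := by
  have h := hf.EE_inv (Λ := Λ) hχ hk hw z lam
  unfold ind
  by_cases hE : EE p D Λ lam (vec f z) k
  · rw [if_pos hE, if_pos (h.2 hE)]
  · rw [if_neg hE, if_neg fun h' => hE (h.1 h')]

theorem sum_ind_le (q D : ℕ) (Λ lam : ℝ) (v : ℕ → ℂ) :
    ∑ k ∈ Finset.Ico 1 D, ind q D Λ lam k v ≤ 1 := by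
  by_cases h : ∃ k ∈ Finset.Ico 1 D, EE q D Λ lam v k
  · obtain ⟨k, hk, hE⟩ := h
    rw [Finset.sum_eq_single_of_mem k hk]
    · unfold ind; split_ifs <;> norm_num
    · intro l hl hlk
      unfold ind
      rw [if_neg]
      intro hE'
      rw [Finset.mem_Ico] at hk hl
      rcases lt_or_gt_of_ne hlk with h | h
      · linarith [hE'.2 k h hk.2.le, hE.1]
      · linarith [hE.2 l h hl.2.le, hE'.1]
  · rw [Finset.sum_eq_zero]
    · norm_num
    · intro k hk
      unfold ind
      rw [if_neg fun hE => h ⟨k, hk, hE⟩]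

theorem HH_zero_split {q D : ℕ} {Λ : ℝ} {v : ℕ → ℂ} {k : ℕ} (hk : k ≤ D) :
    HH q D Λ v 0 = HH q D Λ v k + ∑ l ∈ Finset.Ico 0 k, hh q D Λ v l := by
  unfold HH
  rw [add_comm, Finset.sum_Ico_consecutive _ (Nat.zero_le k) hk]

theorem Fam.ind_HH (hf : Fam p χ j D a0 f) (hχ : IsChar p χ) {k : ℕ} (hk : k ≤ D) (lam : ℝ) :
    ∫ z, ind p D Λ lam k (vec f z) * HH p D Λ (vec f z) k ^ 2 ∂(μ.prod μ)
      ≤ ∫ z, ind p D Λ lam k (vec f z) * HH p D Λ (vec f z) 0 ^ 2 ∂(μ.prod μ) := by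
  have hcross : ∫ z, ∑ l ∈ Finset.Ico 0 k,
      (ind p D Λ lam k (vec f z) * HH p D Λ (vec f z) k) * hh p D Λ (vec f z) l ∂(μ.prod μ) = 0 := by
    rw [integral_finsetSum _ fun l _ => hf.integrable μ hχ (fun v =>
      (ind p D Λ lam k v * HH p D Λ v k) * hh p D Λ v l) (by simp [hh_zero])]
    refine Finset.sum_eq_zero fun l hl => ?_
    rw [Finset.mem_Ico] at hl
    refine hf.orth_scale μ hχ (by omega) (fun v => ind p D Λ lam k v * HH p D Λ v k) fun z s hs => ?_
    have hadm : Adm p j a0 k s 0 := (adm_horizontal hs).mono hl.2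
    rw [hf.ind_inv hχ hk hadm z lam, hf.HH_inv hχ le_rfl hadm z]
  have i1 := hf.integrable μ hχ (fun v => ind p D Λ lam k v * HH p D Λ v k ^ 2) (by simp [HH_zero])
  have i2 := hf.integrable μ hχ (fun v => 2 * ∑ l ∈ Finset.Ico 0 k,
      (ind p D Λ lam k v * HH p D Λ v k) * hh p D Λ v l) (by simp [hh_zero])
  have i3 := hf.integrable μ hχ (fun v => ind p D Λ lam k v * HH p D Λ v 0 ^ 2) (by simp [HH_zero])
  have h5 : ∫ z, (ind p D Λ lam k (vec f z) * HH p D Λ (vec f z) k ^ 2 + 2 * ∑ l ∈ Finset.Ico 0 k,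
      (ind p D Λ lam k (vec f z) * HH p D Λ (vec f z) k) * hh p D Λ (vec f z) l) ∂(μ.prod μ)
      ≤ ∫ z, ind p D Λ lam k (vec f z) * HH p D Λ (vec f z) 0 ^ 2 ∂(μ.prod μ) := by
    refine integral_mono (i1.add i2) i3 fun z => ?_
    simp only
    rw [HH_zero_split hk, ← Finset.mul_sum]
    have := mul_nonneg (ind_nonneg p D Λ lam k (vec f z))
      (sq_nonneg (∑ l ∈ Finset.Ico 0 k, hh p D Λ (vec f z) l))
    nlinarith
  rw [integral_add i1 i2, integral_const_mul, hcross] at h5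
  linarith

open scoped Classical in
/-- The level set estimate for a pair of children of the root. -/
theorem Fam.pair (hf : Fam p χ j D a0 f) (hχ : IsChar p χ) (h2 : p ≠ 2) {lam β : ℝ}
    (hlam : 0 < lam) (hβ : 0 < β) (hβ2 : 8 * lam < β ^ 2) (hD : 1 ≤ D)
    (hg : ∀ z, ∑ c ∈ Finset.range (p ^ D), ‖f c z‖ ^ 2 ≤ lam) {i i' : ℕ} (hi : i < p)
    (hii : i ≠ i') :
    β ^ 6 * ∫ z, (if β ≤ ‖∑ c ∈ (Finset.range (p ^ D)).filter (fun c => c % p = i), f c z‖ ∧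
        β ≤ ‖∑ c ∈ (Finset.range (p ^ D)).filter (fun c => c % p = i'), f c z‖ then (1 : ℝ) else 0)
        ∂(μ.prod μ)
      ≤ 1024 * (p : ℝ) ^ 3 * D * lam ^ 2 *
        ∫ z, ∑ c ∈ Finset.range (p ^ D), ‖f c z‖ ^ 2 ∂(μ.prod μ) := by
  obtain ⟨Λ, hΛ⟩ : ∃ Λ : ℝ, Λ = 4 * lam / β := ⟨_, rfl⟩
  have hΛ0 : 0 < Λ := by rw [hΛ]; positivity
  have eA : ∀ z i, ∑ c ∈ (Finset.range (p ^ D)).filter (fun c => c % p = i), f c z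
      = AA p D Λ (vec f z) D i := by
    intro z i; unfold AA; simp only [lv_top]; rfl
  have eg : ∀ z, ∑ c ∈ Finset.range (p ^ D), ‖f c z‖ ^ 2 = gg p D Λ (vec f z) D := by
    intro z; unfold gg; simp only [lv_top]; rfl
  simp only [eA]
  simp only [eg] at hg ⊢
  set J : (ℕ → ℂ) → ℝ := fun v => if β ≤ ‖AA p D Λ v D i‖ ∧ β ≤ ‖AA p D Λ v D i'‖ then (1 : ℝ) else 0
    with hJ
  have J0 : J 0 = 0 := by
    simp only [hJ, AA_zero, norm_zero]
    rw [if_neg]; rintro ⟨h, -⟩; linarith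
  have iX : ∀ k, Integrable (fun z => ind p D Λ lam k (vec f z) *
      (‖AA p D Λ (vec f z) k i‖ ^ 2 * ‖AA p D Λ (vec f z) k i'‖ ^ 2)) (μ.prod μ) := fun k =>
    hf.integrable μ hχ (fun v => ind p D Λ lam k v * (‖AA p D Λ v k i‖ ^ 2 * ‖AA p D Λ v k i'‖ ^ 2))
      (by simp [AA_zero])
  have iH : ∀ k, Integrable (fun z => ind p D Λ lam k (vec f z) * HH p D Λ (vec f z) 0 ^ 2)
      (μ.prod μ) := fun k =>
    hf.integrable μ hχ (fun v => ind p D Λ lam k v * HH p D Λ v 0 ^ 2) (by simp [HH_zero])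
  have s1 : β ^ 4 / 16 * ∫ z, J (vec f z) ∂(μ.prod μ) ≤ ∑ k ∈ Finset.Ico 1 D,
      ∫ z, ind p D Λ lam k (vec f z) *
      (‖AA p D Λ (vec f z) k i‖ ^ 2 * ‖AA p D Λ (vec f z) k i'‖ ^ 2) ∂(μ.prod μ) := by
    rw [← integral_finsetSum _ fun k _ => iX k, ← integral_const_mul]
    refine integral_mono (hf.integrable μ hχ (fun v => β ^ 4 / 16 * J v) (by simp [J0]))
      (integrable_finsetSum _ fun k _ => iX k) fun z => ?_
    have hnn : ∀ k ∈ Finset.Ico 1 D, 0 ≤ ind p D Λ lam k (vec f z) *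
      (‖AA p D Λ (vec f z) k i‖ ^ 2 * ‖AA p D Λ (vec f z) k i'‖ ^ 2) := fun k _ =>
      mul_nonneg (ind_nonneg _ _ _ _ _ _) (by positivity)
    simp only [hJ]
    split_ifs with h
    · obtain ⟨k, hk, hE, h3, h4⟩ := prune_level hlam hβ hβ2 hΛ hD (hg z) hi h.1 h.2
      refine le_trans ?_ (Finset.single_le_sum hnn hk)
      unfold ind
      rw [if_pos hE, one_mul, mul_one]
      calc β ^ 4 / 16 = (β / 2) ^ 2 * (β / 2) ^ 2 := by ring
        _ ≤ _ := by gcongr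
    · simpa using Finset.sum_nonneg hnn
  have s2 : ∀ k ∈ Finset.Ico 1 D, ∫ z, ind p D Λ lam k (vec f z) *
      (‖AA p D Λ (vec f z) k i‖ ^ 2 * ‖AA p D Λ (vec f z) k i'‖ ^ 2) ∂(μ.prod μ)
      ≤ 4 * ∫ z, ind p D Λ lam k (vec f z) * HH p D Λ (vec f z) 0 ^ 2 ∂(μ.prod μ) := by
    intro k hk
    have hkD : k ≤ D := (Finset.mem_Ico.1 hk).2.le
    refine (hf.bilinear μ hχ h2 hkD (ind p D Λ lam k) (ind_nonneg _ _ _ _ _)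
      (fun z s t hw => hf.ind_inv hχ hkD hw z lam) hii).trans ?_
    refine le_trans ?_ (mul_le_mul_of_nonneg_left (hf.ind_HH μ hχ hkD lam) (by norm_num))
    rw [← integral_const_mul]
    refine integral_mono
      (hf.integrable μ hχ (fun v => ind p D Λ lam k v * gg p D Λ v k ^ 2) (by simp [gg_zero]))
      (hf.integrable μ hχ (fun v => 4 * (ind p D Λ lam k v * HH p D Λ v k ^ 2)) (by simp [HH_zero]))
      fun z => ?_
    simp only [ind]
    split_ifs with hE
    · linarith [gg_sq_le hkD (hg z) hE.1]
    · simp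
  have s3 : ∑ k ∈ Finset.Ico 1 D,
      ∫ z, ind p D Λ lam k (vec f z) * HH p D Λ (vec f z) 0 ^ 2 ∂(μ.prod μ)
      ≤ ∫ z, HH p D Λ (vec f z) 0 ^ 2 ∂(μ.prod μ) := by
    rw [← integral_finsetSum _ fun k _ => iH k]
    refine integral_mono (integrable_finsetSum _ fun k _ => iH k)
      (hf.integrable μ hχ (fun v => HH p D Λ v 0 ^ 2) (by simp [HH_zero])) fun z => ?_
    simp only
    rw [← Finset.sum_mul]
    have := sum_ind_le p D Λ lam (vec f z)
    nlinarith [sq_nonneg (HH p D Λ (vec f z) 0)]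
  have s4 := hf.HH_sq (Λ := Λ) μ hχ h2 hΛ0.le (Nat.zero_le D)
  have s5 := s1.trans (Finset.sum_le_sum s2)
  rw [← Finset.mul_sum] at s5
  set S := ∫ z, gg p D Λ (vec f z) D ∂(μ.prod μ)
  set X := ∫ z, J (vec f z) ∂(μ.prod μ)
  have s6 : β ^ 4 / 16 * X ≤ 4 * (((D : ℝ) - (0 : ℕ)) * ((p : ℝ) ^ 3 * Λ ^ 2 * S)) :=
    s5.trans (mul_le_mul_of_nonneg_left (s3.trans s4) (by norm_num))
  have s7 : β ^ 6 * X = 16 * β ^ 2 * (β ^ 4 / 16 * X) := by ring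
  rw [s7]
  refine (mul_le_mul_of_nonneg_left s6 (by positivity)).trans (le_of_eq ?_)
  rw [hΛ]
  push_cast
  field_simp
  ring


theorem sum_filter_mod {M : Type*} [AddCommMonoid M] {q : ℕ} (d : ℕ) (φ : ℕ → M) {i : ℕ}
    (hi : i < q) :
    ∑ c ∈ (Finset.range (q ^ (d + 1))).filter (fun c => c % q = i), φ c
      = ∑ c ∈ Finset.range (q ^ d), φ (i + c * q) := by
  have hq : 0 < q := by omega
  refine Finset.sum_bij' (fun c _ => c / q) (fun c _ => i + c * q) ?_ ?_ ?_ ?_ ?_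
  · intro c hc
    rw [Finset.mem_filter, Finset.mem_range] at hc
    rw [Finset.mem_range, Nat.div_lt_iff_lt_mul hq, ← pow_succ]
    exact hc.1
  · intro c hc
    rw [Finset.mem_range] at hc
    rw [Finset.mem_filter, Finset.mem_range]
    constructor
    · calc i + c * q < q + c * q := by omega
        _ = (c + 1) * q := by ring
        _ ≤ q ^ d * q := Nat.mul_le_mul_right _ hc
        _ = _ := by ring
    · rw [Nat.add_mul_mod_self_right, Nat.mod_eq_of_lt hi]
  · intro c hc
    rw [Finset.mem_filter] at hc
    rw [← hc.2]; exact Nat.mod_add_div' c q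
  · intro c _
    rw [Nat.add_mul_div_right _ _ hq, Nat.div_eq_of_lt hi, zero_add]
  · intro c hc
    rw [Finset.mem_filter] at hc
    rw [← hc.2, Nat.mod_add_div']

theorem sum_split' {M : Type*} [AddCommMonoid M] {q : ℕ} (hq : 0 < q) (d : ℕ) (φ : ℕ → M) :
    ∑ c ∈ Finset.range (q ^ (d + 1)), φ c
      = ∑ i ∈ Finset.range q, ∑ c ∈ Finset.range (q ^ d), φ (i + c * q) := by
  rw [← Finset.sum_fiberwise_of_maps_to (t := Finset.range q) (g := fun c => c % q)
    (fun c _ => Finset.mem_range.2 (Nat.mod_lt _ hq))]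
  exact Finset.sum_congr rfl fun i hi => sum_filter_mod d φ (Finset.mem_range.1 hi)

/-- truncated sixth power -/
noncomputable def Wt (s x : ℝ) : ℝ := if 3 * s ≤ x then x ^ 6 else 0

theorem Wt_nonneg (s x : ℝ) : 0 ≤ Wt s x := by
  unfold Wt; split_ifs
  · positivity
  · exact le_rfl

theorem dyadic {b x : ℝ} (hb : 0 < b) (hx : b ≤ x) (M : ℕ) (hM : x < b * 2 ^ M) :
    x ^ 6 ≤ ∑ n ∈ Finset.range M, 64 * ((b * 2 ^ n) ^ 6 * if b * 2 ^ n ≤ x then (1 : ℝ) else 0) := by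
  induction M with
  | zero => simp at hM; linarith
  | succ M ih =>
    rw [Finset.sum_range_succ]
    by_cases h : x < b * 2 ^ M
    · refine (ih h).trans (le_add_of_nonneg_right ?_)
      split_ifs <;> positivity
    · push Not at h
      rw [if_pos h]
      refine le_trans ?_ (le_add_of_nonneg_left (Finset.sum_nonneg fun n _ => ?_))
      · calc x ^ 6 ≤ (b * 2 ^ (M + 1)) ^ 6 := by
              have : 0 ≤ x := hb.le.trans hx
              gcongr
          _ = _ := by ring
      · split_ifs <;> positivity

open scoped Classical in
/-- Sixth moment of a pair of children. -/
theorem Fam.levelsum {d : ℕ} (hf : Fam p χ j (d + 1) a0 f) (hχ : IsChar p χ) (h2 : p ≠ 2) {s : ℝ}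
    (hs : 0 < s) (hg : ∀ z, ∑ c ∈ Finset.range (p ^ (d + 1)), ‖f c z‖ ^ 2 ≤ s ^ 2)
    {i i' : ℕ} (hi : i < p) (hi' : i' < p) (hii : i ≠ i') :
    ∫ z, Wt s (min ‖∑ c ∈ Finset.range (p ^ d), f (i + c * p) z‖
        ‖∑ c ∈ Finset.range (p ^ d), f (i' + c * p) z‖) ∂(μ.prod μ)
      ≤ 65536 * (p : ℝ) ^ 4 * ((d : ℝ) + 1) ^ 2 * s ^ 4 *
        ∫ z, ∑ c ∈ Finset.range (p ^ (d + 1)), ‖f c z‖ ^ 2 ∂(μ.prod μ) := by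
  have hp1 := one_lt_p (p := p)
  set S := ∫ z, ∑ c ∈ Finset.range (p ^ (d + 1)), ‖f c z‖ ^ 2 ∂(μ.prod μ)
  let A : ℕ → (ℕ → ℂ) → ℂ := fun i v => ∑ c ∈ Finset.range (p ^ d), v (i + c * p)
  let β : ℕ → ℝ := fun n => 3 * s * 2 ^ n
  have hβ0 : ∀ n, 0 < β n := fun n => by positivity
  let J : ℕ → (ℕ → ℂ) → ℝ := fun n v => if β n ≤ min ‖A i v‖ ‖A i' v‖ then 1 else 0
  have J0 : ∀ n, J n 0 = 0 := by
    intro n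
    simp only [J, A]
    rw [if_neg]
    simpa using hβ0 n
  have W0 : Wt s (min ‖A i 0‖ ‖A i' 0‖) = 0 := by
    simp [Wt, A]
  have hpt : ∀ z, Wt s (min ‖A i (vec f z)‖ ‖A i' (vec f z)‖)
      ≤ ∑ n ∈ Finset.range (p * (d + 1)), 64 * (β n ^ 6 * J n (vec f z)) := by
    intro z
    unfold Wt
    split_ifs with h
    · refine dyadic (b := 3 * s) (by positivity) h _ ?_
      refine (min_le_left _ _).trans_lt ?_
      have hc : ∀ c ∈ Finset.range (p ^ d), ‖vec f z (i + c * p)‖ ≤ s := by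
        intro c hc
        have hlt : i + c * p ∈ Finset.range (p ^ (d + 1)) := by
          rw [Finset.mem_range] at hc ⊢
          calc i + c * p < p + c * p := by omega
            _ = (c + 1) * p := by ring
            _ ≤ p ^ d * p := Nat.mul_le_mul_right _ hc
            _ = _ := by ring
        have := (Finset.single_le_sum (f := fun c => ‖f c z‖ ^ 2) (fun _ _ => by positivity)
          hlt).trans (hg z)
        exact le_of_sq_le_sq this hs.le
      have h3 : ‖A i (vec f z)‖ ≤ (p ^ d : ℕ) * s := by
        refine (norm_sum_le_of_le _ hc).trans ?_
        simp
      have h4 : ((p ^ d : ℕ) : ℝ) ≤ 2 ^ (p * (d + 1)) := by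
        have : p ^ d ≤ 2 ^ (p * (d + 1)) := by
          rw [pow_mul]
          calc p ^ d ≤ (2 ^ p) ^ d := Nat.pow_le_pow_left Nat.lt_two_pow_self.le _
            _ ≤ _ := Nat.pow_le_pow_right (by positivity) (by omega)
        exact_mod_cast this
      have h5 : (0 : ℝ) < 2 ^ (p * (d + 1)) := by positivity
      nlinarith
    · refine Finset.sum_nonneg fun n _ => ?_
      simp only [J]
      have := hβ0 n
      split_ifs <;> positivity
  have iJ : ∀ n, Integrable (fun z => 64 * (β n ^ 6 * J n (vec f z))) (μ.prod μ) := fun n =>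
    hf.integrable μ hχ (fun v => 64 * (β n ^ 6 * J n v)) (by simp [J0])
  have hmain := integral_mono (hf.integrable μ hχ (fun v => Wt s (min ‖A i v‖ ‖A i' v‖)) W0)
    (integrable_finsetSum _ fun n _ => iJ n) hpt
  refine hmain.trans ?_
  rw [integral_finsetSum _ fun n _ => iJ n]
  have hn : ∀ n ∈ Finset.range (p * (d + 1)), ∫ z, 64 * (β n ^ 6 * J n (vec f z)) ∂(μ.prod μ)
      ≤ 64 * (1024 * (p : ℝ) ^ 3 * (d + 1 : ℕ) * (s ^ 2) ^ 2 * S) := by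
    intro n _
    rw [integral_const_mul, integral_const_mul]
    have h3 : s ≤ s * 2 ^ n := le_mul_of_one_le_right hs.le (one_le_pow₀ (by norm_num))
    have := hf.pair μ hχ h2 (lam := s ^ 2) (β := β n) (by positivity) (hβ0 n)
      (by simp only [β]; nlinarith) (by omega) hg hi hii
    simp only [sum_filter_mod d _ hi, sum_filter_mod d _ hi', ← le_min_iff] at this
    exact mul_le_mul_of_nonneg_left this (by norm_num)
  refine (Finset.sum_le_sum hn).trans (le_of_eq ?_)
  rw [Finset.sum_const, Finset.card_range, nsmul_eq_mul]
  push_cast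
  ring

/-- Sum of all sibling interactions in the tree. -/
noncomputable def XX (q : ℕ) (s : ℝ) : ℕ → (ℕ → ℂ) → ℝ
  | 0, _ => 0
  | d + 1, v => (∑ i ∈ Finset.range q, ∑ i' ∈ (Finset.range q).erase i,
      Wt s (min ‖∑ c ∈ Finset.range (q ^ d), v (i + c * q)‖
        ‖∑ c ∈ Finset.range (q ^ d), v (i' + c * q)‖))
      + ∑ i ∈ Finset.range q, XX q s d (fun c => v (i + c * q))

theorem XX_nonneg (q : ℕ) (s : ℝ) (d : ℕ) (v : ℕ → ℂ) : 0 ≤ XX q s d v := by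
  induction d generalizing v with
  | zero => simp [XX]
  | succ d ih =>
    unfold XX
    exact add_nonneg (Finset.sum_nonneg fun i _ => Finset.sum_nonneg fun i' _ => Wt_nonneg _ _)
      (Finset.sum_nonneg fun i _ => ih _)

theorem XX_zero (q : ℕ) {s : ℝ} (hs : 0 < s) (d : ℕ) : XX q s d 0 = 0 := by
  induction d with
  | zero => simp [XX]
  | succ d ih =>
    have : (fun c : ℕ => (0 : ℂ)) = 0 := rfl
    simp [XX, this, ih, Wt]

theorem tree_bound (q : ℕ) (hq : 0 < q) {s B : ℝ} (hs : 0 ≤ s) (hB : 3 * s ≤ B) (d : ℕ) (v : ℕ → ℂ)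
    (hv : ∑ c ∈ Finset.range (q ^ d), ‖v c‖ ^ 2 ≤ s ^ 2) (hX : XX q s d v ≤ B ^ 6) :
    ‖∑ c ∈ Finset.range (q ^ d), v c‖ ≤ s + d * q * B := by
  have hB0 : 0 ≤ B := by linarith
  induction d generalizing v with
  | zero =>
    simp at hv ⊢
    exact abs_le_of_sq_le_sq' (by simpa using hv) hs |>.2
  | succ d ih =>
    rw [sum_split' hq] at hv ⊢
    unfold XX at hX
    set A : ℕ → ℂ := fun i => ∑ c ∈ Finset.range (q ^ d), v (i + c * q) with hA
    have hsub0 : 0 ≤ ∑ i ∈ Finset.range q, XX q s d (fun c => v (i + c * q)) :=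
      Finset.sum_nonneg fun i _ => XX_nonneg _ _ _ _
    have hpair0 : 0 ≤ ∑ i ∈ Finset.range q, ∑ i' ∈ (Finset.range q).erase i,
        Wt s (min ‖A i‖ ‖A i'‖) :=
      Finset.sum_nonneg fun i _ => Finset.sum_nonneg fun i' _ => Wt_nonneg _ _
    have hmin : ∀ i ∈ Finset.range q, ∀ i' ∈ (Finset.range q).erase i, min ‖A i‖ ‖A i'‖ ≤ B := by
      intro i hi i' hi'
      have h1 : Wt s (min ‖A i‖ ‖A i'‖) ≤ B ^ 6 := by
        have h3 := Finset.single_le_sum (f := fun i' => Wt s (min ‖A i‖ ‖A i'‖))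
          (fun _ _ => Wt_nonneg _ _) hi'
        have h4 := Finset.single_le_sum (f := fun i => ∑ i' ∈ (Finset.range q).erase i,
          Wt s (min ‖A i‖ ‖A i'‖)) (fun _ _ => Finset.sum_nonneg fun i' _ => Wt_nonneg _ _) hi
        linarith
      unfold Wt at h1
      split_ifs at h1 with h
      · exact le_of_pow_le_pow_left₀ (by norm_num) hB0 h1
      · push Not at h; linarith
    obtain ⟨i0, hi0, hmax⟩ := Finset.exists_max_image (Finset.range q) (fun i => ‖A i‖)
      ⟨0, Finset.mem_range.2 hq⟩
    have hoth : ∀ i ∈ (Finset.range q).erase i0, ‖A i‖ ≤ B := by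
      intro i hi
      have := hmin i0 hi0 i hi
      rwa [min_eq_right (hmax i (Finset.mem_of_mem_erase hi))] at this
    have hi0b : ‖A i0‖ ≤ s + d * q * B := by
      apply ih
      · refine le_trans ?_ hv
        exact Finset.single_le_sum (f := fun i => ∑ c ∈ Finset.range (q ^ d), ‖v (i + c * q)‖ ^ 2)
          (fun _ _ => Finset.sum_nonneg fun _ _ => by positivity) hi0
      · have := Finset.single_le_sum (f := fun i => XX q s d (fun c => v (i + c * q)))
          (fun _ _ => XX_nonneg _ _ _ _) hi0
        linarith
    rw [← Finset.add_sum_erase _ _ hi0]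
    refine (norm_add_le _ _).trans ?_
    have h6 : ‖∑ i ∈ (Finset.range q).erase i0, A i‖ ≤ q * B := by
      refine (norm_sum_le_of_le _ hoth).trans ?_
      rw [Finset.sum_const, nsmul_eq_mul]
      gcongr
      simpa using Finset.card_erase_le (s := Finset.range q) (a := i0)
    push_cast
    calc _ ≤ (s + d * q * B) + q * B := add_le_add hi0b h6
      _ = _ := by ring

theorem tree_six (q : ℕ) (hq : 0 < q) {s : ℝ} (hs : 0 ≤ s) (d : ℕ) (v : ℕ → ℂ)
    (hv : ∑ c ∈ Finset.range (q ^ d), ‖v c‖ ^ 2 ≤ s ^ 2) :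
    ‖∑ c ∈ Finset.range (q ^ d), v c‖ ^ 6
      ≤ (4 * q * ((d : ℝ) + 1)) ^ 4 * s ^ 4 * ‖∑ c ∈ Finset.range (q ^ d), v c‖ ^ 2
        + (4 * q * ((d : ℝ) + 1)) ^ 6 * XX q s d v := by
  set y := ‖∑ c ∈ Finset.range (q ^ d), v c‖ with hy
  have hy0 : 0 ≤ y := norm_nonneg _
  have hX0 := XX_nonneg q s d v
  have hq1 : (1 : ℝ) ≤ q := by exact_mod_cast hq
  have hd0 : (0 : ℝ) ≤ d := by positivity
  by_cases h : XX q s d v ≤ (3 * s) ^ 6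
  · have h1 : y ≤ s + d * q * (3 * s) := tree_bound q hq hs le_rfl d v hv h
    have h3 : y ≤ 4 * q * ((d : ℝ) + 1) * s := by
      refine h1.trans ?_
      have : 0 ≤ d * q * s := by positivity
      nlinarith
    have h4 : y ^ 4 ≤ (4 * q * ((d : ℝ) + 1) * s) ^ 4 := by gcongr
    calc y ^ 6 = y ^ 4 * y ^ 2 := by ring
      _ ≤ (4 * q * ((d : ℝ) + 1) * s) ^ 4 * y ^ 2 := by gcongr
      _ = (4 * q * ((d : ℝ) + 1)) ^ 4 * s ^ 4 * y ^ 2 := by ring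
      _ ≤ _ := le_add_of_nonneg_right (by positivity)
  · push Not at h
    obtain ⟨B, hB0, hB⟩ : ∃ B : ℝ, 0 ≤ B ∧ B ^ 6 = XX q s d v :=
      ⟨(XX q s d v) ^ ((6 : ℕ) : ℝ)⁻¹, Real.rpow_nonneg hX0 _,
        Real.rpow_inv_natCast_pow hX0 (by norm_num)⟩
    have hsB : 3 * s ≤ B := by
      apply le_of_pow_le_pow_left₀ (n := 6) (by norm_num) hB0
      rw [hB]; exact h.le
    have h1 := tree_bound q hq hs hsB d v hv hB.ge
    have h3 : y ≤ 4 * q * ((d : ℝ) + 1) * B := by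
      refine h1.trans ?_
      have : 0 ≤ d * q * B := by positivity
      nlinarith
    calc y ^ 6 ≤ (4 * q * ((d : ℝ) + 1) * B) ^ 6 := by gcongr
      _ = (4 * q * ((d : ℝ) + 1)) ^ 6 * XX q s d v := by rw [mul_pow, hB]
      _ ≤ _ := le_add_of_nonneg_left (by positivity)

/-- restriction to a subtree -/
theorem Fam.sub {d : ℕ} (hf : Fam p χ j (d + 1) a0 f) (i : ℕ) :
    Fam p χ (j + 1) d (a0 + i * p ^ j) (fun c => f (i + c * p)) := by
  have hc : ∀ c, cen p (j + 1) (a0 + i * p ^ j) c = cen p j a0 (i + c * p) := by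
    intro c; unfold cen; push_cast; ring
  have e : j + 1 + d = j + (d + 1) := by ring
  constructor
  · intro c z s t hs ht
    rw [hc, e] at *
    exact hf.eqv _ z s t hs (by rwa [e] at ht)
  · obtain ⟨M, hM⟩ := hf.supp
    exact ⟨M, fun c z hz => hM _ z hz⟩

theorem Fam.XX_integral (hχ : IsChar p χ) (h2 : p ≠ 2) {s : ℝ} (hs : 0 < s) :
    ∀ (d j a0 : ℕ) (f : ℕ → ℚ_[p] × ℚ_[p] → ℂ), Fam p χ j d a0 f →
    (∀ z, ∑ c ∈ Finset.range (p ^ d), ‖f c z‖ ^ 2 ≤ s ^ 2) →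
    ∫ z, XX p s d (vec f z) ∂(μ.prod μ) ≤ 65536 * (p : ℝ) ^ 6 * (d : ℝ) ^ 3 * s ^ 4 *
        ∫ z, ∑ c ∈ Finset.range (p ^ d), ‖f c z‖ ^ 2 ∂(μ.prod μ) := by
  intro d
  induction d with
  | zero => intro j a0 f hf hg; simp [XX]
  | succ d ih =>
    intro j a0 f hf hg
    have iW : ∀ i i', Integrable (fun z =>
        Wt s (min ‖∑ c ∈ Finset.range (p ^ d), f (i + c * p) z‖
        ‖∑ c ∈ Finset.range (p ^ d), f (i' + c * p) z‖)) (μ.prod μ) := fun i i' =>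
      hf.integrable μ hχ (fun v => Wt s (min ‖∑ c ∈ Finset.range (p ^ d), v (i + c * p)‖
        ‖∑ c ∈ Finset.range (p ^ d), v (i' + c * p)‖)) (by simp [Wt])
    have iX : ∀ i, Integrable (fun z => XX p s d (vec (fun c => f (i + c * p)) z)) (μ.prod μ) :=
      fun i => (hf.sub i).integrable μ hχ (XX p s d) (XX_zero p hs d)
    have iS : ∀ i, Integrable (fun z => ∑ c ∈ Finset.range (p ^ d), ‖f (i + c * p) z‖ ^ 2)
      (μ.prod μ) := fun i =>
      hf.integrable μ hχ (fun v => ∑ c ∈ Finset.range (p ^ d), ‖v (i + c * p)‖ ^ 2) (by simp)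
    have hS : ∫ z, ∑ c ∈ Finset.range (p ^ (d + 1)), ‖f c z‖ ^ 2 ∂(μ.prod μ)
        = ∑ i ∈ Finset.range p, ∫ z, ∑ c ∈ Finset.range (p ^ d), ‖f (i + c * p) z‖ ^ 2 ∂(μ.prod μ) := by
      rw [← integral_finsetSum _ fun i _ => iS i]
      simp only [sum_split' hp.out.pos d]
    have e : ∀ z, XX p s (d + 1) (vec f z) = (∑ i ∈ Finset.range p, ∑ i' ∈ (Finset.range p).erase i,
      Wt s (min ‖∑ c ∈ Finset.range (p ^ d), f (i + c * p) z‖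
        ‖∑ c ∈ Finset.range (p ^ d), f (i' + c * p) z‖))
      + ∑ i ∈ Finset.range p, XX p s d (vec (fun c => f (i + c * p)) z) := fun z => rfl
    simp only [e]
    rw [integral_add (integrable_finsetSum _ fun i _ => integrable_finsetSum _ fun i' _ => iW i i')
      (integrable_finsetSum _ fun i _ => iX i),
      integral_finsetSum _ fun i _ => integrable_finsetSum _ fun i' _ => iW i i',
      integral_finsetSum _ fun i _ => iX i]
    set S := ∫ z, ∑ c ∈ Finset.range (p ^ (d + 1)), ‖f c z‖ ^ 2 ∂(μ.prod μ) with hSdef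
    have hS0 : 0 ≤ S := integral_nonneg fun z => Finset.sum_nonneg fun _ _ => by positivity
    have h3 : ∑ i ∈ Finset.range p, ∫ z, ∑ i' ∈ (Finset.range p).erase i,
      Wt s (min ‖∑ c ∈ Finset.range (p ^ d), f (i + c * p) z‖
        ‖∑ c ∈ Finset.range (p ^ d), f (i' + c * p) z‖) ∂(μ.prod μ)
        ≤ (p : ℝ) * (p * (65536 * (p : ℝ) ^ 4 * ((d : ℝ) + 1) ^ 2 * s ^ 4 * S)) := by
      have h4 : ∀ i ∈ Finset.range p, ∫ z, ∑ i' ∈ (Finset.range p).erase i,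
        Wt s (min ‖∑ c ∈ Finset.range (p ^ d), f (i + c * p) z‖
          ‖∑ c ∈ Finset.range (p ^ d), f (i' + c * p) z‖) ∂(μ.prod μ)
          ≤ (p * (65536 * (p : ℝ) ^ 4 * ((d : ℝ) + 1) ^ 2 * s ^ 4 * S)) := by
        intro i hi
        rw [integral_finsetSum _ fun i' _ => iW i i']
        refine (Finset.sum_le_sum fun i' hi' => hf.levelsum μ hχ h2 hs hg (Finset.mem_range.1 hi)
          (Finset.mem_range.1 (Finset.mem_of_mem_erase hi')) (Finset.ne_of_mem_erase hi').symm).trans ?_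
        rw [Finset.sum_const, nsmul_eq_mul]
        gcongr
        simpa using Finset.card_erase_le (s := Finset.range p) (a := i)
      refine (Finset.sum_le_sum h4).trans (le_of_eq ?_)
      rw [Finset.sum_const, nsmul_eq_mul, Finset.card_range]
    have h5 : ∑ i ∈ Finset.range p, ∫ z, XX p s d (vec (fun c => f (i + c * p)) z) ∂(μ.prod μ)
        ≤ 65536 * (p : ℝ) ^ 6 * (d : ℝ) ^ 3 * s ^ 4 * S := by
      rw [hS, Finset.mul_sum]
      refine Finset.sum_le_sum fun i hi => ih _ _ _ (hf.sub i) fun z => ?_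
      refine le_trans ?_ (hg z)
      rw [sum_split' hp.out.pos]
      exact Finset.single_le_sum (f := fun i => ∑ c ∈ Finset.range (p ^ d), ‖f (i + c * p) z‖ ^ 2)
          (fun _ _ => Finset.sum_nonneg fun _ _ => by positivity) hi
    refine (add_le_add h3 h5).trans ?_
    push_cast
    have h6 : (p : ℝ) * (p * (65536 * (p : ℝ) ^ 4 * ((d : ℝ) + 1) ^ 2 * s ^ 4 * S))
        + 65536 * (p : ℝ) ^ 6 * (d : ℝ) ^ 3 * s ^ 4 * S
        = (65536 * (p : ℝ) ^ 6 * s ^ 4 * S) * (((d : ℝ) + 1) ^ 2 + (d : ℝ) ^ 3) := by ring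
    have h7 : 65536 * (p : ℝ) ^ 6 * ((d : ℝ) + 1) ^ 3 * s ^ 4 * S
        = (65536 * (p : ℝ) ^ 6 * s ^ 4 * S) * ((d : ℝ) + 1) ^ 3 := by ring
    rw [h6, h7]
    refine mul_le_mul_of_nonneg_left ?_ (by positivity)
    have : (0 : ℝ) ≤ d := by positivity
    nlinarith

/-- orthogonality -/
theorem Fam.plancherel (hf : Fam p χ j D a0 f) (hχ : IsChar p χ) :
    ∫ z, ‖∑ c ∈ Finset.range (p ^ D), f c z‖ ^ 2 ∂(μ.prod μ)
      = ∫ z, ∑ c ∈ Finset.range (p ^ D), ‖f c z‖ ^ 2 ∂(μ.prod μ) := by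
  obtain ⟨x0, hx0, hx1⟩ := hχ.nontriv
  rw [← Complex.ofReal_inj, ← integral_complex_ofReal, ← integral_complex_ofReal]
  have e1 : ∀ z, ((‖∑ c ∈ Finset.range (p ^ D), f c z‖ ^ 2 : ℝ) : ℂ)
      = ∑ c ∈ Finset.range (p ^ D), ∑ d ∈ Finset.range (p ^ D),
        f c z * (starRingEnd ℂ) (f d z) := by
    intro z
    rw [← Complex.normSq_eq_norm_sq, ← Complex.mul_conj, map_sum, Finset.sum_mul_sum]
  have e2 : ∀ z, ((∑ c ∈ Finset.range (p ^ D), ‖f c z‖ ^ 2 : ℝ) : ℂ)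
      = ∑ c ∈ Finset.range (p ^ D), f c z * (starRingEnd ℂ) (f c z) := by
    intro z
    rw [Complex.ofReal_sum]
    refine Finset.sum_congr rfl fun c _ => ?_
    rw [Complex.mul_conj, Complex.normSq_eq_norm_sq]
  have hIntg : ∀ c d, Integrable (fun z => f c z * (starRingEnd ℂ) (f d z)) (μ.prod μ) := fun c d =>
    hf.integrable μ hχ (fun v => v c * (starRingEnd ℂ) (v d)) (by simp)
  simp only [e1, e2]
  rw [integral_finsetSum _ fun c _ => integrable_finsetSum _ fun d _ => hIntg c d,
    integral_finsetSum _ fun c _ => hIntg c c]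
  refine Finset.sum_congr rfl fun c hc => ?_
  rw [integral_finsetSum _ fun d _ => hIntg c d, Finset.sum_eq_single_of_mem c hc]
  intro d hd hdc
  have hfar := cen_far (p := p) (j := j) (a0 := a0) (Finset.mem_range.1 hc) (Finset.mem_range.1 hd)
    hdc.symm
  set a := cen p j a0 c with ha
  set a' := cen p j a0 d with ha'
  obtain ⟨hy0, hs⟩ := div_bound hx0 hfar
  have hadm : Adm p j a0 D (x0 / (a - a')) 0 := adm_horizontal hs
  refine vanish μ (x0 / (a - a'), 0) (χ x0) hx1 fun z => ?_
  rw [hf.eqv c z _ _ (hadm.1 _) hadm.2, hf.eqv d z _ _ (hadm.1 _) hadm.2, pair_char hχ, ← ha, ← ha']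
  have : (a - a') * (x0 / (a - a') + (a + a') * 0) = x0 := by field_simp; ring
  rw [this]

/-- The linear `L⁶` estimate. -/
theorem Fam.linear (hf : Fam p χ j D a0 f) (hχ : IsChar p χ) (h2 : p ≠ 2) {lam : ℝ}
    (hlam : 0 ≤ lam) (hg : ∀ z, ∑ c ∈ Finset.range (p ^ D), ‖f c z‖ ^ 2 ≤ lam) :
    ∫ z, ‖∑ c ∈ Finset.range (p ^ D), f c z‖ ^ 6 ∂(μ.prod μ)
      ≤ ((4 * (p : ℝ)) ^ 4 + (4 * (p : ℝ)) ^ 6 * (65536 * (p : ℝ) ^ 6)) * ((D : ℝ) + 1) ^ 9 * lam ^ 2 *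
        ∫ z, ∑ c ∈ Finset.range (p ^ D), ‖f c z‖ ^ 2 ∂(μ.prod μ) := by
  set S := ∫ z, ∑ c ∈ Finset.range (p ^ D), ‖f c z‖ ^ 2 ∂(μ.prod μ) with hS
  have hS0 : 0 ≤ S := integral_nonneg fun z => Finset.sum_nonneg fun _ _ => by positivity
  rcases hlam.eq_or_lt with h0 | hpos
  · have hz : ∀ z, ∑ c ∈ Finset.range (p ^ D), f c z = 0 := by
      intro z
      refine Finset.sum_eq_zero fun c hc => ?_
      have := (Finset.single_le_sum (f := fun c => ‖f c z‖ ^ 2) (fun _ _ => by positivity)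
          hc).trans (hg z)
      simp only [← h0] at this
      have h3 : ‖f c z‖ ^ 2 = 0 := le_antisymm this (by positivity)
      simpa using h3
    simp only [hz, norm_zero]
    rw [← h0]; simp
  · obtain ⟨s, hs, hsl⟩ : ∃ s : ℝ, 0 < s ∧ s ^ 2 = lam :=
      ⟨√lam, Real.sqrt_pos.2 hpos, Real.sq_sqrt hlam⟩
    subst hsl
    have hpt : ∀ z, ‖∑ c ∈ Finset.range (p ^ D), f c z‖ ^ 6
      ≤ (4 * p * ((D : ℝ) + 1)) ^ 4 * s ^ 4 * ‖∑ c ∈ Finset.range (p ^ D), f c z‖ ^ 2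
        + (4 * p * ((D : ℝ) + 1)) ^ 6 * XX p s D (vec f z) := fun z =>
      tree_six p hp.out.pos hs.le D (vec f z) (hg z)
    have i1 := hf.integrable μ hχ (fun v => ‖∑ c ∈ Finset.range (p ^ D), v c‖ ^ 6) (by simp)
    have i2 := hf.integrable μ hχ (fun v => (4 * p * ((D : ℝ) + 1)) ^ 4 * s ^ 4 *
      ‖∑ c ∈ Finset.range (p ^ D), v c‖ ^ 2) (by simp)
    have i3 := hf.integrable μ hχ (fun v => (4 * p * ((D : ℝ) + 1)) ^ 6 * XX p s D v)
      (by simp [XX_zero p hs])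
    have h3 := integral_mono i1 (i2.add i3) hpt
    refine h3.trans ?_
    have h4 : ∫ z, ((4 * p * ((D : ℝ) + 1)) ^ 4 * s ^ 4 * ‖∑ c ∈ Finset.range (p ^ D), f c z‖ ^ 2
        + (4 * p * ((D : ℝ) + 1)) ^ 6 * XX p s D (vec f z)) ∂(μ.prod μ)
        = (4 * p * ((D : ℝ) + 1)) ^ 4 * s ^ 4 * S + (4 * p * ((D : ℝ) + 1)) ^ 6 *
          ∫ z, XX p s D (vec f z) ∂(μ.prod μ) := by
      rw [hS, ← hf.plancherel μ hχ, ← integral_const_mul, ← integral_const_mul]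
      exact integral_add i2 i3
    refine h4.le.trans ?_
    have h5 := Fam.XX_integral μ hχ h2 hs D j a0 f hf hg
    have hD0 : (0 : ℝ) ≤ D := by positivity
    have hE : (1 : ℝ) ≤ (D : ℝ) + 1 := by linarith
    have h6 : ((D : ℝ) + 1) ^ 4 ≤ ((D : ℝ) + 1) ^ 9 := pow_le_pow_right₀ hE (by norm_num)
    have h7 : ((D : ℝ) + 1) ^ 6 * (D : ℝ) ^ 3 ≤ ((D : ℝ) + 1) ^ 9 := by
      calc _ ≤ ((D : ℝ) + 1) ^ 6 * ((D : ℝ) + 1) ^ 3 := by gcongr; linarith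
        _ = _ := by ring
    calc _ ≤ (4 * p * ((D : ℝ) + 1)) ^ 4 * s ^ 4 * S + (4 * p * ((D : ℝ) + 1)) ^ 6 *
          (65536 * (p : ℝ) ^ 6 * (D : ℝ) ^ 3 * s ^ 4 * S) := by gcongr
      _ = (4 * (p : ℝ)) ^ 4 * s ^ 4 * S * ((D : ℝ) + 1) ^ 4
          + (4 * (p : ℝ)) ^ 6 * (65536 * (p : ℝ) ^ 6) * s ^ 4 * S *
            (((D : ℝ) + 1) ^ 6 * (D : ℝ) ^ 3) := by ring
      _ ≤ (4 * (p : ℝ)) ^ 4 * s ^ 4 * S * ((D : ℝ) + 1) ^ 9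
          + (4 * (p : ℝ)) ^ 6 * (65536 * (p : ℝ) ^ 6) * s ^ 4 * S * ((D : ℝ) + 1) ^ 9 := by gcongr
      _ = _ := by ring


/-! ### Part D: the Fourier projections form an adapted family -/

theorem IsChar.cont (hχ : IsChar p χ) : Continuous χ := by
  rw [continuous_iff_continuousAt]
  intro x
  have : χ =ᶠ[nhds x] fun _ => χ x := by
    filter_upwards [Metric.ball_mem_nhds x one_pos] with y hy
    exact hχ.congr (by rw [← dist_eq_norm]; exact (Metric.mem_ball.1 hy).le)
  exact continuousAt_const.congr this.symm

theorem qpItv_closed (ℓ a : ℕ) : IsClosed (qpItv p ℓ a) := by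
  have : qpItv p ℓ a = Metric.closedBall (a : ℚ_[p]) ((p : ℝ) ^ (-(ℓ : ℤ))) := by
    ext x; simp [qpItv, dist_eq_norm]
  rw [this]; exact Metric.isClosed_closedBall

theorem mem_qpItv {ℓ a : ℕ} {ξ : ℚ_[p]} :
    ξ ∈ qpItv p ℓ a ↔ ‖ξ - (a : ℚ_[p])‖ ≤ ((p : ℝ) ^ ℓ)⁻¹ := by
  unfold qpItv; rw [Set.mem_ofPred_eq, zpow_neg, zpow_natCast]

theorem strip_meas (ℓ a : ℕ) : MeasurableSet (qpItv p ℓ a ×ˢ (Set.univ : Set ℚ_[p])) :=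
  (qpItv_closed ℓ a).measurableSet.prod MeasurableSet.univ

theorem qpItv_union (j D a0 : ℕ) : qpItv p j a0 ×ˢ (Set.univ : Set ℚ_[p])
    = ⋃ c ∈ Finset.range (p ^ D), qpItv p (j + D) (a0 + c * p ^ j) ×ˢ (Set.univ : Set ℚ_[p]) := by
  have hp1 := one_lt_p (p := p)
  have hp0 : (p : ℚ_[p]) ≠ 0 := by exact_mod_cast hp.out.ne_zero
  ext ⟨ξ, η⟩
  simp only [Set.mem_prod, Set.mem_univ, and_true, Set.mem_iUnion, mem_qpItv, exists_prop,
    Finset.mem_range]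
  constructor
  · intro h
    have hy : ‖(ξ - a0) / (p : ℚ_[p]) ^ j‖ ≤ 1 := by
      rw [norm_div, norm_pow, Padic.norm_p, inv_pow]
      exact div_le_one_of_le₀ h (by positivity)
    let y : ℤ_[p] := ⟨_, hy⟩
    refine ⟨y.appr D, PadicInt.appr_lt y D, ?_⟩
    have h1 := PadicInt.appr_spec D y
    rw [← PadicInt.norm_le_pow_iff_mem_span_pow] at h1
    have h3 : ‖(ξ - a0) / (p : ℚ_[p]) ^ j - (y.appr D : ℚ_[p])‖ ≤ ((p : ℝ) ^ D)⁻¹ := by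
      rw [zpow_neg, zpow_natCast] at h1
      rw [PadicInt.norm_def, PadicInt.coe_sub, PadicInt.coe_natCast] at h1
      exact h1
    have h4 : ξ - ((a0 + y.appr D * p ^ j : ℕ) : ℚ_[p])
        = ((ξ - a0) / (p : ℚ_[p]) ^ j - (y.appr D : ℚ_[p])) * (p : ℚ_[p]) ^ j := by
      push_cast; field_simp; ring
    rw [h4, norm_mul, norm_pow, Padic.norm_p, inv_pow, pow_add, mul_inv, mul_comm]
    gcongr
  · rintro ⟨c, hc, h⟩
    have h4 : ξ - (a0 : ℚ_[p]) = (ξ - ((a0 + c * p ^ j : ℕ) : ℚ_[p])) + c * (p : ℚ_[p]) ^ j := by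
      push_cast; ring
    rw [h4]
    refine norm_add_le_of (h.trans ?_) ?_
    · gcongr
      · exact hp1.le
      · omega
    · rw [norm_mul, norm_pow, Padic.norm_p, inv_pow]
      exact mul_le_of_le_one_left (by positivity) (norm_nat_le _)

variable {F : ℚ_[p] × ℚ_[p] → ℂ}

theorem fourier_inv (hχ : IsChar p χ) {n : ℕ} (hF : ∀ z, (p : ℝ) ^ n < ‖z‖ → F z = 0)
    (ξ w : ℚ_[p] × ℚ_[p]) (hw : ‖w‖ ≤ ((p : ℝ) ^ n)⁻¹) :
    qpFourier p μ χ F (ξ + w) = qpFourier p μ χ F ξ := by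
  have hp1 := one_lt_p (p := p)
  unfold qpFourier
  refine integral_congr_ae (.of_forall fun x => ?_)
  simp only
  by_cases hx : (p : ℝ) ^ n < ‖x‖
  · rw [hF x hx]; simp
  · push Not at hx
    congr 1
    apply hχ.congr
    have h1 : -((ξ + w).1 * x.1 + (ξ + w).2 * x.2) - -(ξ.1 * x.1 + ξ.2 * x.2)
        = -(w.1 * x.1 + w.2 * x.2) := by
      simp only [Prod.fst_add, Prod.snd_add]; ring
    rw [h1, norm_neg]
    have key : ∀ a b : ℚ_[p], ‖a‖ ≤ ((p : ℝ) ^ n)⁻¹ → ‖b‖ ≤ (p : ℝ) ^ n → ‖a * b‖ ≤ 1 := by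
      intro a b ha hb
      rw [norm_mul]
      calc ‖a‖ * ‖b‖ ≤ ((p : ℝ) ^ n)⁻¹ * (p : ℝ) ^ n := by gcongr
        _ = 1 := by
          have : (p : ℝ) ^ n ≠ 0 := by positivity
          field_simp
    exact norm_add_le_of (key _ _ ((norm_fst_le w).trans hw) ((norm_fst_le x).trans hx))
      (key _ _ ((norm_snd_le w).trans hw) ((norm_snd_le x).trans hx))

/-- The hypotheses on `F`. -/
structure Good (p : ℕ) [Fact p.Prime] (μ : Measure ℚ_[p]) [SigmaFinite μ]
    (χ : ℚ_[p] → ℂ) (F : ℚ_[p] × ℚ_[p] → ℂ) (n m : ℕ) : Prop where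
  cpt : ∀ z, (p : ℝ) ^ n < ‖z‖ → F z = 0
  supp : ∀ ξ : ℚ_[p] × ℚ_[p], ¬ (‖ξ.1‖ ≤ 1 ∧ ‖ξ.2 - ξ.1 ^ 2‖ ≤ ((p : ℝ) ^ (2 * m))⁻¹) →
    qpFourier p μ χ F ξ = 0

variable {n m : ℕ}

theorem Good.integrable (hG : Good p μ χ F n m) (hχ : IsChar p χ) (z : ℚ_[p] × ℚ_[p]) :
    Integrable (fun ξ : ℚ_[p] × ℚ_[p] => qpFourier p μ χ F ξ * χ (ξ.1 * z.1 + ξ.2 * z.2))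
      (μ.prod μ) := by
  have hp1 := one_lt_p (p := p)
  have hc : Continuous (qpFourier p μ χ F) :=
    nice_continuous (δ := ((p : ℝ) ^ n)⁻¹) (by positivity) fun ξ w hw =>
      fourier_inv μ hχ hG.cpt ξ w hw
  have hχc := hχ.cont
  refine Continuous.integrable_of_hasCompactSupport ?_ (nice_hcs (M := 1) fun ξ hξ => ?_)
  · fun_prop
  · rw [hG.supp, zero_mul]
    rintro ⟨h1, h2⟩
    have h3 : ‖ξ.2‖ ≤ 1 := by
      have : ξ.2 = (ξ.2 - ξ.1 ^ 2) + ξ.1 ^ 2 := by ring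
      rw [this]
      refine norm_add_le_of (h2.trans (inv_le_one_of_one_le₀ (one_le_ppow _))) ?_
      rw [norm_pow]; exact pow_le_one₀ (norm_nonneg _) h1
    have : ‖ξ‖ ≤ 1 := by rw [Prod.norm_def]; exact max_le h1 h3
    linarith

theorem Good.proj_sum (hG : Good p μ χ F n m) (hχ : IsChar p χ) (j D a0 : ℕ)
    (z : ℚ_[p] × ℚ_[p]) :
    qpProj p μ χ F (qpItv p j a0) z
      = ∑ c ∈ Finset.range (p ^ D), qpProj p μ χ F (qpItv p (j + D) (a0 + c * p ^ j)) z := by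
  have hp1 := one_lt_p (p := p)
  unfold qpProj
  rw [qpItv_union j D a0, integral_biUnion_finset]
  · exact fun c _ => strip_meas _ _
  · intro c hc d hd hcd
    rw [Function.onFun, Set.disjoint_left]
    rintro ⟨ξ, η⟩ h1 h2
    simp only [Set.mem_prod, mem_qpItv, Set.mem_univ, and_true] at h1 h2
    have hfar := cen_far (p := p) (j := j) (a0 := a0) (n := D)
      (by simpa using hc) (by simpa using hd) hcd
    unfold cen at hfar
    set a : ℚ_[p] := ((a0 + c * p ^ j : ℕ) : ℚ_[p])
    set b : ℚ_[p] := ((a0 + d * p ^ j : ℕ) : ℚ_[p])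
    have h3 : a - b = (ξ - b) - (ξ - a) := by ring
    have h4 : ‖a - b‖ ≤ ((p : ℝ) ^ (j + D))⁻¹ := by rw [h3]; exact norm_sub_le_of h2 h1
    have h5 : ‖a - b‖ * (p : ℝ) ^ (j + D) ≤ 1 := by
      rw [← le_div_iff₀ (by positivity), one_div]; exact h4
    linarith
  · exact fun c _ => (hG.integrable μ hχ z).integrableOn

theorem Good.proj_eqv (hG : Good p μ χ F n m) (hχ : IsChar p χ) {L a : ℕ} (hL : L ≤ m)
    (z : ℚ_[p] × ℚ_[p]) (s t : ℚ_[p])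
    (hs : ‖s + 2 * (a : ℚ_[p]) * t‖ ≤ (p : ℝ) ^ L) (ht : ‖t‖ ≤ ((p : ℝ) ^ L) ^ 2) :
    qpProj p μ χ F (qpItv p L a) (z + (s, t))
      = χ ((a : ℚ_[p]) * s + (a : ℚ_[p]) ^ 2 * t) * qpProj p μ χ F (qpItv p L a) z := by
  have hp1 := one_lt_p (p := p)
  unfold qpProj
  rw [← integral_const_mul]
  refine setIntegral_congr_fun (strip_meas _ _) fun ξ hξ => ?_
  by_cases h : ‖ξ.1‖ ≤ 1 ∧ ‖ξ.2 - ξ.1 ^ 2‖ ≤ ((p : ℝ) ^ (2 * m))⁻¹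
  · have h1 : ‖ξ.1 - (a : ℚ_[p])‖ ≤ ((p : ℝ) ^ L)⁻¹ := mem_qpItv.1 (Set.mem_prod.1 hξ).1
    have h2 : ‖ξ.2 - ξ.1 ^ 2‖ ≤ (((p : ℝ) ^ L)⁻¹) ^ 2 := by
      refine h.2.trans ?_
      rw [inv_pow, ← pow_mul]
      exact inv_anti₀ (by positivity) (pow_le_pow_right₀ hp1.le (by omega))
    set Q : ℝ := (p : ℝ) ^ L
    have hQ : 0 < Q := by positivity
    have e : ξ.1 * (z + (s, t)).1 + ξ.2 * (z + (s, t)).2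
        = (ξ.1 * s + ξ.2 * t) + (ξ.1 * z.1 + ξ.2 * z.2) := by
      simp only [Prod.fst_add, Prod.snd_add]; ring
    have e2 : χ (ξ.1 * s + ξ.2 * t) = χ ((a : ℚ_[p]) * s + (a : ℚ_[p]) ^ 2 * t) := by
      apply hχ.congr
      have : ξ.1 * s + ξ.2 * t - ((a : ℚ_[p]) * s + (a : ℚ_[p]) ^ 2 * t)
          = (ξ.1 - a) * (s + 2 * a * t) + ((ξ.2 - ξ.1 ^ 2) + (ξ.1 - a) ^ 2) * t := by ring
      rw [this]
      apply norm_add_le_of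
      · rw [norm_mul]
        calc _ ≤ Q⁻¹ * Q := by gcongr
          _ = 1 := by field_simp
      · rw [norm_mul]
        have h3 : ‖(ξ.2 - ξ.1 ^ 2) + (ξ.1 - a) ^ 2‖ ≤ (Q⁻¹) ^ 2 := by
          refine norm_add_le_of h2 ?_
          rw [norm_pow]; gcongr
        calc _ ≤ (Q⁻¹) ^ 2 * Q ^ 2 := by gcongr
          _ = 1 := by field_simp
    rw [e, hχ.mul, e2]; ring
  · rw [hG.supp ξ h]; simp

theorem Good.proj_supp (hG : Good p μ χ F n m) (hχ : IsChar p χ) {L a : ℕ}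
    (z : ℚ_[p] × ℚ_[p]) (hz : (p : ℝ) ^ (n + L + 1) < ‖z‖) :
    qpProj p μ χ F (qpItv p L a) z = 0 := by
  have hp1 := one_lt_p (p := p)
  obtain ⟨x0, hx0, hx1⟩ := hχ.nontriv
  unfold qpProj
  rw [← integral_indicator (strip_meas _ _)]
  have hQ0 : (0 : ℝ) < (p : ℝ) ^ (n + L) := by positivity
  have hdiv : ∀ y : ℚ_[p], (p : ℝ) ^ (n + L + 1) < ‖y‖ →
      y ≠ 0 ∧ ‖x0 / y‖ ≤ ((p : ℝ) ^ (n + L))⁻¹ := by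
    intro y hy
    apply div_bound hx0
    rw [← div_eq_mul_inv, le_div_iff₀ hQ0]
    calc (p : ℝ) * (p : ℝ) ^ (n + L) = (p : ℝ) ^ (n + L + 1) := by ring
      _ ≤ _ := hy.le
  obtain ⟨w, hw, hwz⟩ : ∃ w : ℚ_[p] × ℚ_[p], ‖w‖ ≤ ((p : ℝ) ^ (n + L))⁻¹ ∧
      w.1 * z.1 + w.2 * z.2 = x0 := by
    rw [Prod.norm_def] at hz
    rcases lt_max_iff.1 hz with h | h
    · obtain ⟨h0, h1⟩ := hdiv _ h
      refine ⟨(x0 / z.1, 0), ?_, ?_⟩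
      · rw [Prod.norm_def]; simp only [norm_zero]; exact max_le h1 (by positivity)
      · simp only [zero_mul, add_zero]; exact div_mul_cancel₀ _ h0
    · obtain ⟨h0, h1⟩ := hdiv _ h
      refine ⟨(0, x0 / z.2), ?_, ?_⟩
      · rw [Prod.norm_def]; simp only [norm_zero]; exact max_le (by positivity) h1
      · simp only [zero_mul, zero_add]; exact div_mul_cancel₀ _ h0
  have hwn : ‖w‖ ≤ ((p : ℝ) ^ n)⁻¹ := hw.trans (by gcongr; exacts [hp1.le, by omega])
  have hwL : ‖w.1‖ ≤ ((p : ℝ) ^ L)⁻¹ :=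
    ((norm_fst_le w).trans hw).trans (by gcongr; exacts [hp1.le, by omega])
  refine vanish μ w (χ x0) hx1 fun ξ => ?_
  have hmem : ξ + w ∈ qpItv p L a ×ˢ (Set.univ : Set ℚ_[p]) ↔
      ξ ∈ qpItv p L a ×ˢ (Set.univ : Set ℚ_[p]) := by
    simp only [Set.mem_prod, Set.mem_univ, and_true, mem_qpItv, Prod.fst_add]
    constructor
    · intro h
      have : ξ.1 - (a : ℚ_[p]) = (ξ.1 + w.1 - a) - w.1 := by ring
      rw [this]; exact norm_sub_le_of h hwL
    · intro h
      have : ξ.1 + w.1 - (a : ℚ_[p]) = (ξ.1 - a) + w.1 := by ring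
      rw [this]; exact norm_add_le_of h hwL
  by_cases hξ : ξ ∈ qpItv p L a ×ˢ (Set.univ : Set ℚ_[p])
  · rw [Set.indicator_of_mem hξ, Set.indicator_of_mem (hmem.2 hξ), fourier_inv μ hχ hG.cpt ξ w hwn]
    have e : (ξ + w).1 * z.1 + (ξ + w).2 * z.2 = x0 + (ξ.1 * z.1 + ξ.2 * z.2) := by
      rw [← hwz]; simp only [Prod.fst_add, Prod.snd_add]; ring
    rw [e, hχ.mul]; ring
  · rw [Set.indicator_of_notMem hξ, Set.indicator_of_notMem fun h => hξ (hmem.1 h), mul_zero]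

theorem Good.fam (hG : Good p μ χ F n m) (hχ : IsChar p χ) (j D a0 : ℕ) (hm : j + D ≤ m) :
    Fam p χ j D a0 (fun c z => qpProj p μ χ F (qpItv p (j + D) (a0 + c * p ^ j)) z) := by
  constructor
  · intro c z s t hs ht
    exact hG.proj_eqv μ hχ hm z s t hs ht
  · exact ⟨(p : ℝ) ^ (n + (j + D) + 1), fun c z hz => hG.proj_supp μ hχ z hz⟩

theorem exists_good (hχ : IsChar p χ) (hF : HasCompactSupport F)
    (hsupp : ∀ ξ : ℚ_[p] × ℚ_[p],
        ¬ (‖ξ.1‖ ≤ 1 ∧ ‖ξ.2 - ξ.1 ^ 2‖ ≤ (p : ℝ) ^ (-((2 * m : ℕ) : ℤ))) →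
        qpFourier p μ χ F ξ = 0) : ∃ n, Good p μ χ F n m := by
  have hp1 := one_lt_p (p := p)
  obtain ⟨r, hr⟩ := hF.isCompact.isBounded.subset_closedBall 0
  obtain ⟨n, hn⟩ := pow_unbounded_of_one_lt r hp1
  refine ⟨n, ⟨fun z hz => ?_, fun ξ hξ => hsupp ξ ?_⟩⟩
  · by_contra h
    have h1 := hr (subset_tsupport F (Function.mem_support.2 h))
    rw [mem_closedBall_zero_iff] at h1
    linarith
  · rwa [zpow_neg, zpow_natCast]


/-! ### Part E: assembly -/

theorem mem_sub {ℓ' ℓ a b : ℕ} :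
    b ∈ qpSubItv p ℓ' ℓ a ↔ b < p ^ ℓ' ∧ b % p ^ ℓ = a % p ^ ℓ := by
  classical
  unfold qpSubItv
  rw [Finset.mem_filter, Finset.mem_range, mem_qpItv]
  exact and_congr_right fun _ => ⟨norm_dvd, norm_of_mod⟩

theorem sub_sum {M : Type*} [AddCommMonoid M] (ℓ ℓ1 D a : ℕ) (h : ℓ ≤ ℓ1) (φ : ℕ → M) :
    ∑ b ∈ qpSubItv p ℓ1 ℓ a, ∑ c ∈ Finset.range (p ^ D), φ (b + c * p ^ ℓ1)
      = ∑ b ∈ qpSubItv p (ℓ1 + D) ℓ a, φ b := by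
  have hP : 0 < p ^ ℓ1 := pow_pos hp.out.pos _
  have hdvd : p ^ ℓ ∣ p ^ ℓ1 := pow_dvd_pow _ h
  rw [← Finset.sum_product']
  refine Finset.sum_nbij' (fun x => x.1 + x.2 * p ^ ℓ1) (fun n => (n % p ^ ℓ1, n / p ^ ℓ1))
    ?_ ?_ ?_ ?_ ?_
  · rintro ⟨b, c⟩ hx
    rw [Finset.mem_product, mem_sub, Finset.mem_range] at hx
    rw [mem_sub]
    obtain ⟨⟨h1, h2⟩, h3⟩ := hx
    simp only at h1 h2 h3 ⊢
    constructor
    · rw [pow_add]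
      have : (c + 1) * p ^ ℓ1 ≤ p ^ D * p ^ ℓ1 := Nat.mul_le_mul_right _ h3
      nlinarith
    · rw [← h2, Nat.add_mod, Nat.mod_eq_zero_of_dvd (hdvd.mul_left c), add_zero, Nat.mod_mod]
  · intro n hn
    rw [mem_sub] at hn
    rw [Finset.mem_product, mem_sub, Finset.mem_range]
    refine ⟨⟨Nat.mod_lt _ hP, ?_⟩, ?_⟩
    · simp only
      rw [Nat.mod_mod_of_dvd _ hdvd]; exact hn.2
    · simp only
      rw [Nat.div_lt_iff_lt_mul hP, mul_comm, ← pow_add]; exact hn.1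
  · rintro ⟨b, c⟩ hx
    rw [Finset.mem_product, mem_sub, Finset.mem_range] at hx
    have h1 : b < p ^ ℓ1 := hx.1.1
    simp only [Prod.mk.injEq]
    constructor
    · rw [Nat.add_mul_mod_self_right, Nat.mod_eq_of_lt h1]
    · rw [Nat.add_mul_div_right _ _ hP, Nat.div_eq_of_lt h1, zero_add]
  · intro n hn
    exact Nat.mod_add_div' n (p ^ ℓ1)
  · intro x hx
    rfl

theorem Good.le_sup (hG : Good p μ χ F n m) (hχ : IsChar p χ) {L : ℕ} (hL : L ≤ m) (b : ℕ)
    (z : ℚ_[p] × ℚ_[p]) :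
    ‖qpProj p μ χ F (qpItv p L b) z‖ ≤ ⨆ x, ‖qpProj p μ χ F (qpItv p L b) x‖ := by
  have hf := hG.fam μ hχ L 0 b (by omega)
  have hc : Continuous fun z => ‖qpProj p μ χ F (qpItv p L b) z‖ := by
    have := hf.cont hχ (fun v => ‖v 0‖)
    simpa [vec] using this
  have hs : HasCompactSupport fun z => ‖qpProj p μ χ F (qpItv p L b) z‖ :=
    nice_hcs (M := (p : ℝ) ^ (n + L + 1)) fun z hz => by rw [hG.proj_supp μ hχ z hz, norm_zero]
  exact le_ciSup (hc.bddAbove_range_of_hasCompactSupport hs) z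

theorem Good.int_pow (hG : Good p μ χ F n m) (hχ : IsChar p χ) {L : ℕ} (hL : L ≤ m) (b e : ℕ)
    (he : e ≠ 0) :
    Integrable (fun z => ‖qpProj p μ χ F (qpItv p L b) z‖ ^ e) (μ.prod μ) := by
  have hf := hG.fam μ hχ L 0 b (by omega)
  have := hf.integrable μ hχ (fun v => ‖v 0‖ ^ e) (by simp [he])
  simpa [vec] using this

theorem Good.main (hG : Good p μ χ F n m) (hχ : IsChar p χ) (h2 : p ≠ 2) (ℓ ℓ1 D a : ℕ)
    (h : ℓ ≤ ℓ1) (hm : ℓ1 + D ≤ m) :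
    ∫ x, (⨆ b ∈ qpSubItv p ℓ1 ℓ a, ⨆ b' ∈ qpSubItv p ℓ1 ℓ a, ⨆ _ : b ≠ b',
        ‖qpProj p μ χ F (qpItv p ℓ1 b) x * qpProj p μ χ F (qpItv p ℓ1 b') x‖ ^ 3) ∂(μ.prod μ)
      ≤ ((4 * (p : ℝ)) ^ 4 + (4 * (p : ℝ)) ^ 6 * (65536 * (p : ℝ) ^ 6)) * ((D : ℝ) + 1) ^ 9 *
          (∑ b ∈ qpSubItv p (ℓ1 + D) ℓ a,
            (⨆ x, ‖qpProj p μ χ F (qpItv p (ℓ1 + D) b) x‖) ^ 2) ^ 2 *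
          ∑ b ∈ qpSubItv p (ℓ1 + D) ℓ a,
            ∫ x, ‖qpProj p μ χ F (qpItv p (ℓ1 + D) b) x‖ ^ 2 ∂(μ.prod μ) := by
  set T := qpSubItv p ℓ1 ℓ a with hT
  set lam := ∑ b ∈ qpSubItv p (ℓ1 + D) ℓ a,
            (⨆ x, ‖qpProj p μ χ F (qpItv p (ℓ1 + D) b) x‖) ^ 2 with hlam
  set C0 := (4 * (p : ℝ)) ^ 4 + (4 * (p : ℝ)) ^ 6 * (65536 * (p : ℝ) ^ 6) with hC0
  have hlam0 : 0 ≤ lam := Finset.sum_nonneg fun _ _ => sq_nonneg _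
  have step1 : ∫ x, (⨆ b ∈ T, ⨆ b' ∈ T, ⨆ _ : b ≠ b',
        ‖qpProj p μ χ F (qpItv p ℓ1 b) x * qpProj p μ χ F (qpItv p ℓ1 b') x‖ ^ 3) ∂(μ.prod μ)
      ≤ ∫ x, ∑ b ∈ T, ‖qpProj p μ χ F (qpItv p ℓ1 b) x‖ ^ 6 ∂(μ.prod μ) := by
    refine integral_mono_of_nonneg (.of_forall fun x => ?_)
      (integrable_finsetSum _ fun b _ => hG.int_pow μ hχ (by omega) b 6 (by norm_num))
      (.of_forall fun x => ?_)
    · exact Real.iSup_nonneg fun b => Real.iSup_nonneg fun _ => Real.iSup_nonneg fun b' =>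
        Real.iSup_nonneg fun _ => Real.iSup_nonneg fun _ => by positivity
    · have hs : 0 ≤ ∑ b ∈ T, ‖qpProj p μ χ F (qpItv p ℓ1 b) x‖ ^ 6 :=
        Finset.sum_nonneg fun _ _ => by positivity
      have hone : ∀ b ∈ T, ‖qpProj p μ χ F (qpItv p ℓ1 b) x‖ ^ 6
          ≤ ∑ b ∈ T, ‖qpProj p μ χ F (qpItv p ℓ1 b) x‖ ^ 6 := fun b hb =>
        Finset.single_le_sum (f := fun b => ‖qpProj p μ χ F (qpItv p ℓ1 b) x‖ ^ 6)
          (fun _ _ => by positivity) hb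
      refine Real.iSup_le (fun b => Real.iSup_le (fun hb => Real.iSup_le (fun b' =>
        Real.iSup_le (fun hb' => Real.iSup_le (fun _ => ?_) hs) hs) hs) hs) hs
      rw [norm_mul, mul_pow]
      have h1 := hone b hb
      have h3 := hone b' hb'
      set u := ‖qpProj p μ χ F (qpItv p ℓ1 b) x‖
      set v := ‖qpProj p μ χ F (qpItv p ℓ1 b') x‖
      nlinarith [sq_nonneg (u ^ 3 - v ^ 3)]
  refine step1.trans ?_
  rw [integral_finsetSum _ fun b _ => hG.int_pow μ hχ (by omega) b 6 (by norm_num)]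
  have step2 : ∀ b ∈ T, ∫ x, ‖qpProj p μ χ F (qpItv p ℓ1 b) x‖ ^ 6 ∂(μ.prod μ)
      ≤ C0 * ((D : ℝ) + 1) ^ 9 * lam ^ 2 * ∑ c ∈ Finset.range (p ^ D),
        ∫ x, ‖qpProj p μ χ F (qpItv p (ℓ1 + D) (b + c * p ^ ℓ1)) x‖ ^ 2 ∂(μ.prod μ) := by
    intro b hb
    have hf := hG.fam μ hχ ℓ1 D b hm
    have hlin := hf.linear μ hχ h2 hlam0 (fun z => ?_)
    · rw [integral_finsetSum _ fun c _ => hG.int_pow μ hχ hm _ 2 (by norm_num)] at hlin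
      refine le_trans (le_of_eq ?_) hlin
      refine integral_congr_ae (.of_forall fun x => ?_)
      simp only
      rw [hG.proj_sum μ hχ ℓ1 D b x]
    · rw [hlam, ← sub_sum ℓ ℓ1 D a h]
      refine le_trans (Finset.sum_le_sum fun c _ => ?_)
        (Finset.single_le_sum (f := fun b => ∑ c ∈ Finset.range (p ^ D),
          (⨆ x, ‖qpProj p μ χ F (qpItv p (ℓ1 + D) (b + c * p ^ ℓ1)) x‖) ^ 2)
          (fun _ _ => Finset.sum_nonneg fun _ _ => sq_nonneg _) hb)
      exact pow_le_pow_left₀ (norm_nonneg _) (hG.le_sup μ hχ hm _ z) 2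
  refine (Finset.sum_le_sum step2).trans ?_
  rw [← Finset.mul_sum, sub_sum ℓ ℓ1 D a h
    (fun b => ∫ x, ‖qpProj p μ χ F (qpItv p (ℓ1 + D) b) x‖ ^ 2 ∂(μ.prod μ))]

end padic

end BilinAux

/-- **Bilinear estimate (Proposition 5.1).** For Schwartz `F` with Fourier support in `Ξ_{1/R}`,
every `k < N` and every interval `τ_k` of length `R_k^{-1/2}`,
`∫ max_{τ_{k+1} ≠ τ'_{k+1} ⊂ τ_k} |F_{τ_{k+1}} F_{τ'_{k+1}}|³
  ≤ C (log R)^{9+6ε} (∑_{τ_N ⊂ τ_k} ‖F_{τ_N}‖_∞²)² (∑_{τ_N ⊂ τ_k} ∫ |F_{τ_N}|²)`. -/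
theorem bilinear_estimate (q : ℕ) [Fact q.Prime] (hq2 : q ≠ 2)
    (μ : Measure ℚ_[q]) [μ.IsAddHaarMeasure] [SigmaFinite μ]
    (hμ : μ {x : ℚ_[q] | ‖x‖ ≤ 1} = 1)
    (χ : ℚ_[q] → ℂ)
    (hχ_mul : ∀ x y : ℚ_[q], χ (x + y) = χ x * χ y)
    (hχ_norm : ∀ x : ℚ_[q], ‖χ x‖ = 1)
    (hχ_triv : ∀ x : ℚ_[q], ‖x‖ ≤ 1 → χ x = 1)
    (hχ_nontriv : ∃ x : ℚ_[q], ‖x‖ ≤ (q : ℝ) ∧ χ x ≠ 1)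
    (ε : ℝ) (hε : 0 < ε) (hε1 : ε < 1) :
    ∃ C : ℝ, 0 < C ∧ ∃ R₀ : ℕ, ∀ A : ℕ, 1 / ε ≤ (A : ℝ) → (A : ℝ) ≤ 2 / ε →
      ∀ m : ℕ, R₀ ≤ q ^ (2 * m) →
      ∀ r : ℕ, 4 ∣ r →
        (q : ℝ) ^ ((q : ℝ) ^ ((A : ℝ) * ((r : ℝ) - 4))) ≤ (q : ℝ) ^ (2 * m) →
        ((q : ℝ) ^ (2 * m) : ℝ) < (q : ℝ) ^ ((q : ℝ) ^ ((A : ℝ) * (r : ℝ))) →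
      ∀ N : ℕ, q ^ (N * r) ≤ q ^ (2 * m) → q ^ (2 * m) < q ^ ((N + 1) * r) →
      ∀ F : ℚ_[q] × ℚ_[q] → ℂ, IsLocallyConstant F → HasCompactSupport F →
      (∀ p : ℚ_[q] × ℚ_[q],
        ¬ (‖p.1‖ ≤ 1 ∧ ‖p.2 - p.1 ^ 2‖ ≤ (q : ℝ) ^ (-((2 * m : ℕ) : ℤ))) →
        qpFourier q μ χ F p = 0) →
      ∀ k : ℕ, k < N → ∀ a : ℕ, a ∈ Finset.range (q ^ (k * (r / 2))) →
      ∫ x, (⨆ b ∈ qpSubItv q ((k + 1) * (r / 2)) (k * (r / 2)) a,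
              ⨆ b' ∈ qpSubItv q ((k + 1) * (r / 2)) (k * (r / 2)) a, ⨆ _ : b ≠ b',
                ‖qpProj q μ χ F (qpItv q ((k + 1) * (r / 2)) b) x *
                  qpProj q μ χ F (qpItv q ((k + 1) * (r / 2)) b') x‖ ^ 3) ∂(μ.prod μ)
        ≤ C * (Real.log ((q : ℝ) ^ (2 * m))) ^ ((9 : ℝ) + 6 * ε) *
            (∑ b ∈ qpSubItv q (N * (r / 2)) (k * (r / 2)) a,
                (⨆ x, ‖qpProj q μ χ F (qpItv q (N * (r / 2)) b) x‖) ^ 2) ^ 2 *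
            ∑ b ∈ qpSubItv q (N * (r / 2)) (k * (r / 2)) a,
              ∫ x, ‖qpProj q μ χ F (qpItv q (N * (r / 2)) b) x‖ ^ 2 ∂(μ.prod μ) := by
  have hqp : q.Prime := Fact.out
  have hq3 : 3 ≤ q := by
    have := hqp.two_le
    omega
  have hχ : BilinAux.IsChar q χ := ⟨hχ_mul, hχ_norm, hχ_triv, hχ_nontriv⟩
  refine ⟨(4 * (q : ℝ)) ^ 4 + (4 * (q : ℝ)) ^ 6 * (65536 * (q : ℝ) ^ 6), by positivity, 0, ?_⟩
  intro A _ _ m _ r hr _ _ N hN1 hN2 F _ hFc hsupp k hk a _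
  obtain ⟨n, hG⟩ := BilinAux.exists_good μ hχ hFc hsupp
  have e1 : N * r ≤ 2 * m := (Nat.pow_le_pow_iff_right hqp.one_lt).1 hN1
  have e2 : 2 * m < (N + 1) * r := (Nat.pow_lt_pow_iff_right hqp.one_lt).1 hN2
  obtain ⟨s, rfl⟩ := hr
  have es : 4 * s / 2 = 2 * s := by omega
  rw [es]
  have hs : 1 ≤ s := by
    by_contra h0
    have : s = 0 := by omega
    subst this
    simp at e2
  have hL : N * (2 * s) ≤ m := by nlinarith
  have hle : (k + 1) * (2 * s) ≤ N * (2 * s) := Nat.mul_le_mul_right _ hk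
  obtain ⟨D, hD⟩ := Nat.exists_eq_add_of_le hle
  have hDm : D + 1 ≤ m := by nlinarith
  have hmain := hG.main μ hχ hq2 (k * (2 * s)) ((k + 1) * (2 * s)) D a
    (Nat.mul_le_mul_right _ (by omega)) (by omega)
  rw [hD]
  refine hmain.trans ?_
  have hm1 : (1 : ℝ) ≤ m := by exact_mod_cast (by omega : 1 ≤ m)
  have hDm' : (D : ℝ) + 1 ≤ m := by exact_mod_cast hDm
  have hlog : (m : ℝ) ≤ Real.log ((q : ℝ) ^ (2 * m)) := by
    rw [Real.log_pow]
    have h1 : (1 : ℝ) ≤ Real.log q := by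
      rw [Real.le_log_iff_exp_le (by positivity)]
      have h3 : (3 : ℝ) ≤ q := by exact_mod_cast hq3
      have := Real.exp_one_lt_d9
      linarith
    push_cast
    nlinarith
  have hpow : ((D : ℝ) + 1) ^ 9 ≤ (Real.log ((q : ℝ) ^ (2 * m))) ^ ((9 : ℝ) + 6 * ε) := by
    calc ((D : ℝ) + 1) ^ 9 ≤ (Real.log ((q : ℝ) ^ (2 * m))) ^ 9 :=
          pow_le_pow_left₀ (by positivity) (hDm'.trans hlog) 9
      _ = (Real.log ((q : ℝ) ^ (2 * m))) ^ (9 : ℝ) := by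
          rw [← Real.rpow_natCast]; norm_num
      _ ≤ _ := Real.rpow_le_rpow_of_exponent_le (hm1.trans hlog) (by linarith)
  refine mul_le_mul_of_nonneg_right ?_
    (Finset.sum_nonneg fun _ _ => integral_nonneg fun _ => by positivity)
  refine mul_le_mul_of_nonneg_right ?_ (sq_nonneg _)
  exact mul_le_mul_of_nonneg_left hpow (by positivity)
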